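/- Let π = (π_i)_{i≥0} be a probability distribution on the nonnegative integers with Σ_k k²π_k < ∞ that is supercritical, i.e. its generating function f satisfies f″(1) > f′(1). Then there exists t_max > 0 such that the infinite system (S) of differential equations z_i′(t) = f_i(z_0(t), z_1(t), …) with initial conditions z_i(0) = π_i has exactly one solution (z_i)_{i≥0} on the interval [0, t_max). -/

import Mathlib

open Set

/-- First moment `∑ⱼ j zⱼ` of a sequence. -/
noncomputable def Emom (z : ℕ → ℝ) : ℝ := ∑' j : ℕ, (j : ℝ) * z j

/-- Second factorial moment `∑ⱼ j (j-1) zⱼ` of a sequence. -/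
noncomputable def Qmom (z : ℕ → ℝ) : ℝ := ∑' j : ℕ, (j : ℝ) * ((j : ℝ) - 1) * z j

/-- Size-biased generating series `ĝ_z(s) = (∑ᵢ i zᵢ s^(i-1)) / (∑ⱼ j zⱼ)`. -/
noncomputable def ghat (z : ℕ → ℝ) (s : ℝ) : ℝ :=
  (∑' i : ℕ, (i : ℝ) * z i * s ^ (i - 1)) / Emom z

/-- Right-hand side `f_i(z)` of the system (S), where `ρ` is the largest solution in `[0,1]`
of `1 - ρ = ĝ_z(1 - ρ)`. -/
noncomputable def fS (z : ℕ → ℝ) (ρ : ℝ) (i : ℕ) : ℝ :=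
  -(1 / ρ) * ((i : ℝ) * z i / Emom z)
    + (1 / ρ) * (1 - Qmom z / Emom z)
      * (((i : ℝ) * z i - ((i : ℝ) + 1) * z (i + 1)) / Emom z)

/-- `z` (together with the family of fixed points `ρ t`) is a solution of the system (S)
on `[0, tmax)` with initial condition `π`. -/
def IsSolS (π : ℕ → ℝ) (tmax : ℝ) (z : ℕ → ℝ → ℝ) (ρ : ℝ → ℝ) : Prop :=
  (∀ i, z i 0 = π i) ∧
  ∀ t ∈ Ico (0 : ℝ) tmax,
    (∀ i, 0 ≤ z i t) ∧
    Summable (fun i => z i t) ∧ (∑' i : ℕ, z i t) ≤ 1 ∧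
    Summable (fun i : ℕ => (i : ℝ) * z i t) ∧ 0 < Emom (fun i => z i t) ∧
    Summable (fun i : ℕ => (i : ℝ) * ((i : ℝ) - 1) * z i t) ∧
    IsGreatest {r | r ∈ Icc (0 : ℝ) 1 ∧ 1 - r = ghat (fun i => z i t) (1 - r)} (ρ t) ∧
    ∀ i, HasDerivWithinAt (fun u => z i u) (fS (fun j => z j t) (ρ t) i) (Ico (0 : ℝ) tmax) t

/-- The power series `F_i = (∑ₖ zₖ xᵏ)⁽ⁱ⁾ / i!`. -/
noncomputable def taylorCoeff (z : ℕ → ℝ) (i : ℕ) (x : ℝ) : ℝ :=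
  ∑' j : ℕ, z (j + i) * ((j + i).choose i : ℝ) * x ^ j

/-- Coefficients of the generating function of `z` composed with `s ↦ a + b s`. -/
noncomputable def affineComp (z : ℕ → ℝ) (a b : ℝ) (i : ℕ) : ℝ := taylorCoeff z i a * b ^ i

/-- Generating function. -/
noncomputable def genFun (z : ℕ → ℝ) (x : ℝ) : ℝ := ∑' k : ℕ, z k * x ^ k

/-- First derivative of the generating function. -/
noncomputable def genFun₁ (z : ℕ → ℝ) (x : ℝ) : ℝ := ∑' k : ℕ, (k : ℝ) * z k * x ^ (k - 1)

/-- Second derivative of the generating function. -/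
noncomputable def genFun₂ (z : ℕ → ℝ) (x : ℝ) : ℝ :=
  ∑' k : ℕ, (k : ℝ) * ((k : ℝ) - 1) * z k * x ^ (k - 2)

section AffineComp

lemma hasSum_affineComp {z w P : ℕ → ℝ} {a b : ℝ} (hz : ∀ i, 0 ≤ z i) (hw : ∀ i, 0 ≤ w i)
    (ha : 0 ≤ a) (hb : 0 ≤ b)
    (hP : ∀ k, ∑ p ∈ Finset.HasAntidiagonal.antidiagonal k,
      (k.choose p.1 : ℝ) * a ^ p.2 * b ^ p.1 * w p.1 = P k)
    (hs : Summable fun k => z k * P k) :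
    HasSum (fun i => w i * affineComp z a b i) (∑' k, z k * P k) := by
  set Φ : ℕ × ℕ → ℝ := fun p =>
    w p.1 * b ^ p.1 * (z (p.2 + p.1) * ((p.2 + p.1).choose p.1 : ℝ) * a ^ p.2) with hΦ
  have hΦ0 : ∀ p, 0 ≤ Φ p := fun p => by
    have := hz (p.2 + p.1); have := hw p.1; simp only [hΦ]; positivity
  let e := Finset.HasAntidiagonal.sigmaAntidiagonalEquivProd (A := ℕ)
  have hfib : ∀ k,
      HasSum (fun c : Finset.HasAntidiagonal.antidiagonal k => (Φ ∘ e) ⟨k, c⟩) (z k * P k) := by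
    intro k
    have h := hasSum_fintype (fun c : Finset.HasAntidiagonal.antidiagonal k => (Φ ∘ e) ⟨k, c⟩)
    convert h using 1
    rw [← hP, Finset.mul_sum, ← Finset.sum_coe_sort]
    refine Finset.sum_congr rfl fun c _ => ?_
    have hc : c.1.2 + c.1.1 = k := by
      have := Finset.HasAntidiagonal.mem_antidiagonal.1 c.2; omega
    simp only [Function.comp, e, Finset.HasAntidiagonal.sigmaAntidiagonalEquivProd_apply, hΦ, hc]
    ring
  have hsum : Summable (Φ ∘ e) := by
    refine (summable_sigma_of_nonneg (f := Φ ∘ e) fun x => hΦ0 _).2 ?_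
    exact ⟨fun k => (hfib k).summable, by simpa only [(hfib _).tsum_eq] using hs⟩
  have hΦs : Summable Φ := e.summable_iff.1 hsum
  have htot : ∑' p, Φ p = ∑' k, z k * P k := by
    rw [← e.tsum_eq]
    exact (hsum.hasSum.sigma hfib).tsum_eq.symm ▸ rfl
  rw [← htot]
  refine hΦs.hasSum.prod_fiberwise fun i => ?_
  have hval : ∑' j, Φ (i, j) = w i * affineComp z a b i := by
    simp only [hΦ, tsum_mul_left, affineComp, taylorCoeff]
    ring
  exact hval ▸ (hΦs.prod_factor i).hasSum

lemma sum_antidiagonal_choose (a b s : ℝ) (k : ℕ) :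
    ∑ p ∈ Finset.HasAntidiagonal.antidiagonal k, (k.choose p.1 : ℝ) * a ^ p.2 * b ^ p.1 * s ^ p.1
      = (a + b * s) ^ k := by
  rw [add_comm, (Commute.all (b * s) a).add_pow']
  refine Finset.sum_congr rfl fun p _ => ?_
  rw [nsmul_eq_mul, mul_pow]; ring

lemma sum_antidiagonal_choose₁ (a b s : ℝ) (k : ℕ) :
    ∑ p ∈ Finset.HasAntidiagonal.antidiagonal k,
      (k.choose p.1 : ℝ) * a ^ p.2 * b ^ p.1 * ((p.1 : ℝ) * s ^ (p.1 - 1))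
      = b * ((k : ℝ) * (a + b * s) ^ (k - 1)) := by
  have h1 : HasDerivAt (fun s : ℝ => ∑ p ∈ Finset.HasAntidiagonal.antidiagonal k,
      (k.choose p.1 : ℝ) * a ^ p.2 * b ^ p.1 * s ^ p.1)
      (∑ p ∈ Finset.HasAntidiagonal.antidiagonal k,
      (k.choose p.1 : ℝ) * a ^ p.2 * b ^ p.1 * ((p.1 : ℝ) * s ^ (p.1 - 1))) s :=
    HasDerivAt.fun_sum fun p _ => (hasDerivAt_pow p.1 s).const_mul _
  have h2 : HasDerivAt (fun s : ℝ => (a + b * s) ^ k)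
      ((k : ℝ) * (a + b * s) ^ (k - 1) * (b * 1)) s :=
    (((hasDerivAt_id s).const_mul b).const_add a).pow k
  simp only [sum_antidiagonal_choose] at h1
  rw [h1.unique h2]; ring

lemma sum_antidiagonal_choose₂ (a b s : ℝ) (k : ℕ) :
    ∑ p ∈ Finset.HasAntidiagonal.antidiagonal k,
      (k.choose p.1 : ℝ) * a ^ p.2 * b ^ p.1 * ((p.1 : ℝ) * ((p.1 : ℝ) - 1) * s ^ (p.1 - 2))
      = b ^ 2 * ((k : ℝ) * ((k : ℝ) - 1) * (a + b * s) ^ (k - 2)) := by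
  have key : ∀ (n : ℕ) (x : ℝ), (n : ℝ) * (((n - 1 : ℕ) : ℝ) * x ^ (n - 1 - 1))
      = (n : ℝ) * ((n : ℝ) - 1) * x ^ (n - 2) := by
    intro n x
    rcases n with _ | n
    · simp
    · simp only [Nat.add_sub_cancel]; push_cast
      ring
  have h1 : HasDerivAt (fun s : ℝ => ∑ p ∈ Finset.HasAntidiagonal.antidiagonal k,
      (k.choose p.1 : ℝ) * a ^ p.2 * b ^ p.1 * ((p.1 : ℝ) * s ^ (p.1 - 1)))
      (∑ p ∈ Finset.HasAntidiagonal.antidiagonal k, (k.choose p.1 : ℝ) * a ^ p.2 * b ^ p.1 *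
        ((p.1 : ℝ) * (((p.1 - 1 : ℕ) : ℝ) * s ^ (p.1 - 1 - 1)))) s :=
    HasDerivAt.fun_sum fun p _ => ((hasDerivAt_pow (p.1 - 1) s).const_mul _).const_mul _
  have h2 : HasDerivAt (fun s : ℝ => b * ((k : ℝ) * (a + b * s) ^ (k - 1)))
      (b * ((k : ℝ) * (((k - 1 : ℕ) : ℝ) * (a + b * s) ^ (k - 1 - 1) * (b * 1)))) s :=
    (((((hasDerivAt_id s).const_mul b).const_add a).pow (k - 1)).const_mul _).const_mul _
  simp only [sum_antidiagonal_choose₁] at h1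
  have h3 := h1.unique h2
  simp only [key] at h3
  rw [h3, ← key]; ring

variable {z : ℕ → ℝ} {a b s : ℝ}

lemma Summable.mul_pow_of_le_one {u : ℕ → ℝ} (hu : ∀ i, 0 ≤ u i) (hs : Summable u) {x : ℝ}
    (hx0 : 0 ≤ x) (hx1 : x ≤ 1) (e : ℕ → ℕ) : Summable fun k => u k * x ^ e k :=
  Summable.of_nonneg_of_le (fun k => mul_nonneg (hu k) (pow_nonneg hx0 _))
    (fun k => mul_le_of_le_one_right (hu k) (pow_le_one₀ hx0 hx1)) hs

lemma hasSum_affineComp_mul_pow (hz : ∀ i, 0 ≤ z i) (hs : Summable z) (ha : 0 ≤ a) (hb : 0 ≤ b)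
    (hs0 : 0 ≤ s) (h1 : a + b * s ≤ 1) :
    HasSum (fun i => s ^ i * affineComp z a b i) (genFun z (a + b * s)) :=
  hasSum_affineComp hz (fun i => by positivity) ha hb (sum_antidiagonal_choose a b s)
    (hs.mul_pow_of_le_one hz (by positivity) h1 id)

lemma hasSum_affineComp₁ (hz : ∀ i, 0 ≤ z i) (hs : Summable fun k : ℕ => (k : ℝ) * z k)
    (ha : 0 ≤ a) (hb : 0 ≤ b) (hs0 : 0 ≤ s) (h1 : a + b * s ≤ 1) :
    HasSum (fun i : ℕ => (i : ℝ) * s ^ (i - 1) * affineComp z a b i)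
      (b * genFun₁ z (a + b * s)) := by
  have hs' : Summable fun k : ℕ => (k : ℝ) * z k * (a + b * s) ^ (k - 1) :=
    hs.mul_pow_of_le_one (fun k => mul_nonneg k.cast_nonneg (hz k)) (by positivity) h1 _
  have := hasSum_affineComp (w := fun i : ℕ => (i : ℝ) * s ^ (i - 1)) hz (fun i => by positivity)
    ha hb (sum_antidiagonal_choose₁ a b s) ((hs'.mul_left b).congr fun k => by ring)
  convert this using 1
  rw [genFun₁, ← tsum_mul_left]
  exact tsum_congr fun k => by ring

lemma cast_mul_sub_one_nonneg (k : ℕ) : 0 ≤ (k : ℝ) * ((k : ℝ) - 1) := by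
  rcases k with _ | k
  · simp
  · push_cast; ring_nf; positivity

lemma hasSum_affineComp₂ (hz : ∀ i, 0 ≤ z i)
    (hs : Summable fun k : ℕ => (k : ℝ) * ((k : ℝ) - 1) * z k)
    (ha : 0 ≤ a) (hb : 0 ≤ b) (h1 : a + b ≤ 1) :
    HasSum (fun i : ℕ => (i : ℝ) * ((i : ℝ) - 1) * affineComp z a b i)
      (b ^ 2 * genFun₂ z (a + b)) := by
  have hs' : Summable fun k : ℕ => (k : ℝ) * ((k : ℝ) - 1) * z k * (a + b) ^ (k - 2) :=
    hs.mul_pow_of_le_one (fun k => mul_nonneg (cast_mul_sub_one_nonneg k) (hz k))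
      (by positivity) h1 _
  have := hasSum_affineComp (w := fun i : ℕ => (i : ℝ) * ((i : ℝ) - 1)) hz
    cast_mul_sub_one_nonneg ha hb
    (P := fun k => b ^ 2 * ((k : ℝ) * ((k : ℝ) - 1) * (a + b) ^ (k - 2)))
    (fun k => by simpa using sum_antidiagonal_choose₂ a b 1 k)
    ((hs'.mul_left (b ^ 2)).congr fun k => by ring)
  convert this using 1
  rw [genFun₂, ← tsum_mul_left]
  exact tsum_congr fun k => by ring

lemma affineComp_nonneg (hz : ∀ i, 0 ≤ z i) (ha : 0 ≤ a) (hb : 0 ≤ b) (i : ℕ) :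
    0 ≤ affineComp z a b i :=
  mul_nonneg (tsum_nonneg fun j => by have := hz (j + i); positivity) (pow_nonneg hb i)

lemma affineComp_zero_one (i : ℕ) : affineComp z 0 1 i = z i := by
  rw [affineComp, taylorCoeff, tsum_eq_single 0 (fun j hj => by simp [hj])]
  simp

lemma hasDerivAt_taylorCoeff (hz : ∀ i, |z i| ≤ 1) (i : ℕ) {x : ℝ} (hx : |x| < 1) :
    HasDerivAt (taylorCoeff z i) ((i + 1) * taylorCoeff z (i + 1) x) x := by
  obtain ⟨r, hxr, hr1⟩ := exists_between hx
  have hr0 : 0 ≤ r := (abs_nonneg x).trans hxr.le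
  have hident : ∀ j : ℕ, (((j + 1 + i).choose i : ℝ)) * ((j : ℝ) + 1)
      = (i + 1) * ((j + (i + 1)).choose (i + 1) : ℝ) := by
    intro j
    have h := Nat.choose_succ_right_eq (j + (i + 1)) i
    rw [show j + (i + 1) - i = j + 1 by omega] at h
    rw [show j + 1 + i = j + (i + 1) by omega]
    have h' := congrArg (Nat.cast (R := ℝ)) h
    push_cast at h'
    linarith
  have hsum1 : Summable fun j : ℕ => ((j + (i + 1)).choose (i + 1) : ℝ) * r ^ j :=
    summable_choose_mul_geometric_of_norm_lt_one (i + 1)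
      (by rwa [Real.norm_of_nonneg hr0])
  set u : ℕ → ℝ := fun j => ((j + i).choose i : ℝ) * ((j : ℝ) * r ^ (j - 1)) with hu_def
  have hu : Summable u := by
    rw [← summable_nat_add_iff 1]
    refine (hsum1.mul_left ((i : ℝ) + 1)).congr fun j => ?_
    simp only [hu_def, Nat.add_sub_cancel]
    push_cast
    rw [← mul_assoc, ← mul_assoc, hident]
  have hd : ∀ y ∈ Metric.ball (0 : ℝ) r, |y| < r := fun y hy => by simpa using hy
  have hF := hasDerivAt_tsum_of_isPreconnected (𝕜 := ℝ) (F := ℝ)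
    (g := fun (j : ℕ) y => z (j + i) * ((j + i).choose i : ℝ) * y ^ j)
    (g' := fun (j : ℕ) y => z (j + i) * ((j + i).choose i : ℝ) * ((j : ℝ) * y ^ (j - 1)))
    (y₀ := 0) (y := x) (t := Metric.ball 0 r) hu Metric.isOpen_ball
    (convex_ball 0 r).isPreconnected
    (fun j y _ => (hasDerivAt_pow j y).const_mul _)
    (fun j y hy => by
      have hy' := (hd y hy).le
      rw [Real.norm_eq_abs, abs_mul, abs_mul, abs_mul, abs_pow, Nat.abs_cast, Nat.abs_cast,
        mul_assoc]
      calc |z (j + i)| * (((j + i).choose i : ℝ) * ((j : ℝ) * |y| ^ (j - 1)))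
          ≤ 1 * (((j + i).choose i : ℝ) * ((j : ℝ) * r ^ (j - 1))) := by
            gcongr; exact hz _
        _ = u j := one_mul _)
    (by simp; exact (abs_nonneg x).trans_lt hxr)
    (summable_of_ne_finset_zero (s := {0}) fun j hj => by
      have : j ≠ 0 := by simpa using hj
      simp [this])
    (by simpa using hxr)
  refine hF.congr_deriv ?_
  have hsum2 : Summable fun j : ℕ =>
      z (j + i) * ((j + i).choose i : ℝ) * ((j : ℝ) * x ^ (j - 1)) := by
    refine Summable.of_norm_bounded hu fun j => ?_
    rw [Real.norm_eq_abs, abs_mul, abs_mul, abs_mul, abs_pow, Nat.abs_cast, Nat.abs_cast,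
        mul_assoc]
    calc |z (j + i)| * (((j + i).choose i : ℝ) * ((j : ℝ) * |x| ^ (j - 1)))
        ≤ 1 * (((j + i).choose i : ℝ) * ((j : ℝ) * r ^ (j - 1))) := by
          gcongr; exact hz _
      _ = u j := one_mul _
  rw [hsum2.tsum_eq_zero_add, taylorCoeff, ← tsum_mul_left]
  simp only [Nat.cast_zero, zero_mul, mul_zero, zero_add]
  refine tsum_congr fun j => ?_
  have := hident j
  rw [show j + (i + 1) = j + 1 + i by omega] at this ⊢
  simp only [Nat.add_sub_cancel]
  push_cast
  linear_combination (z (j + 1 + i) * x ^ j) * this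

end AffineComp

section GenFun

variable {z : ℕ → ℝ}

lemma genFun₁_one : genFun₁ z 1 = Emom z := by simp [genFun₁, Emom]

lemma genFun₂_one : genFun₂ z 1 = Qmom z := by simp [genFun₂, Qmom]

lemma norm_mul_pow_le {u x : ℝ} (hu : 0 ≤ u) (hx : x ∈ Icc (0 : ℝ) 1) (n : ℕ) :
    ‖u * x ^ n‖ ≤ u := by
  rw [Real.norm_of_nonneg (mul_nonneg hu (pow_nonneg hx.1 n))]
  exact mul_le_of_le_one_right hu (pow_le_one₀ hx.1 hx.2)

lemma continuousOn_genFun₁ (hz : ∀ i, 0 ≤ z i) (hs : Summable fun k : ℕ => (k : ℝ) * z k) :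
    ContinuousOn (genFun₁ z) (Icc 0 1) :=
  continuousOn_tsum (fun k => by fun_prop) hs
    fun k x hx => norm_mul_pow_le (mul_nonneg k.cast_nonneg (hz k)) hx _

lemma continuousOn_genFun₂ (hz : ∀ i, 0 ≤ z i)
    (hs : Summable fun k : ℕ => (k : ℝ) * ((k : ℝ) - 1) * z k) :
    ContinuousOn (genFun₂ z) (Icc 0 1) :=
  continuousOn_tsum (fun k => by fun_prop) hs
    fun k x hx => norm_mul_pow_le (mul_nonneg (cast_mul_sub_one_nonneg k) (hz k)) hx _

lemma summable_first (hz : ∀ i, 0 ≤ z i) (hs : Summable fun k : ℕ => (k : ℝ) * z k)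
    {x : ℝ} (hx : x ∈ Icc (0 : ℝ) 1) : Summable fun k : ℕ => (k : ℝ) * z k * x ^ (k - 1) :=
  hs.mul_pow_of_le_one (fun k => mul_nonneg k.cast_nonneg (hz k)) hx.1 hx.2 _

lemma genFun₁_nonneg (hz : ∀ i, 0 ≤ z i) {x : ℝ} (hx : 0 ≤ x) : 0 ≤ genFun₁ z x :=
  tsum_nonneg fun k => by have := hz k; positivity

lemma genFun₁_pos (hz : ∀ i, 0 ≤ z i) (hs : Summable fun k : ℕ => (k : ℝ) * z k)
    {k : ℕ} (hk : 0 < k) (hzk : 0 < z k) {x : ℝ} (hx : 0 < x) (hx1 : x ≤ 1) :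
    0 < genFun₁ z x :=
  (summable_first hz hs ⟨hx.le, hx1⟩).tsum_pos
    (fun j => by have := hz j; positivity) k (by positivity)

lemma convexOn_genFun₁ (hz : ∀ i, 0 ≤ z i) (hs : Summable fun k : ℕ => (k : ℝ) * z k) :
    ConvexOn ℝ (Icc 0 1) (genFun₁ z) := by
  refine ⟨convex_Icc 0 1, fun x hx y hy a b ha hb hab => ?_⟩
  have hxy := convex_Icc (0 : ℝ) 1 hx hy ha hb hab
  simp only [smul_eq_mul] at hxy ⊢
  rw [genFun₁, genFun₁, genFun₁, ← tsum_mul_left, ← tsum_mul_left,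
    ← Summable.tsum_add ((summable_first hz hs hx).mul_left a)
      ((summable_first hz hs hy).mul_left b)]
  refine Summable.tsum_le_tsum (fun k => ?_) (summable_first hz hs hxy)
    (((summable_first hz hs hx).mul_left a).add ((summable_first hz hs hy).mul_left b))
  have h := (convexOn_pow (𝕜 := ℝ) (k - 1)).2 (show x ∈ Ici 0 from hx.1)
    (show y ∈ Ici 0 from hy.1) ha hb hab
  have h' := mul_le_mul_of_nonneg_left h (mul_nonneg k.cast_nonneg (hz k))
  refine h'.trans_eq ?_
  simp only [smul_eq_mul]; ring

lemma hasDerivWithinAt_tsum_Icc {g g' : ℕ → ℝ → ℝ} {u : ℕ → ℝ} (hu : Summable u)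
    (hg : ∀ n x, HasDerivAt (g n) (g' n x) x) (hc : ∀ n, Continuous (g' n))
    (hb : ∀ n, ∀ x ∈ Icc (0 : ℝ) 1, ‖g' n x‖ ≤ u n) (h0 : Summable fun n => g n 0)
    {x : ℝ} (hx : x ∈ Icc (0 : ℝ) 1) :
    HasDerivWithinAt (fun y => ∑' n, g n y) (∑' n, g' n x) (Icc 0 1) x := by
  let p : ℝ → ℝ := fun y => projIcc 0 1 zero_le_one y
  have hpc : Continuous p := continuous_subtype_val.comp continuous_projIcc
  have hpx : ∀ y ∈ Icc (0 : ℝ) 1, p y = y := fun y hy => by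
    simp only [p, projIcc_of_mem zero_le_one hy]
  have hpm : ∀ y, p y ∈ Icc (0 : ℝ) 1 := fun y => (projIcc 0 1 zero_le_one y).2
  let G : ℕ → ℝ → ℝ := fun n y => g n 0 + ∫ v in (0 : ℝ)..y, g' n (p v)
  have hGg : ∀ n, ∀ y ∈ Icc (0 : ℝ) 1, G n y = g n y := by
    intro n y hy
    have : ∫ v in (0 : ℝ)..y, g' n (p v) = ∫ v in (0 : ℝ)..y, g' n v := by
      refine intervalIntegral.integral_congr fun v hv => ?_
      rw [uIcc_of_le hy.1] at hv
      simp only [hpx v ⟨hv.1, hv.2.trans hy.2⟩]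
    simp only [G, this]
    rw [intervalIntegral.integral_eq_sub_of_hasDerivAt (fun v _ => hg n v)
      ((hc n).intervalIntegrable _ _)]
    ring
  have hG : ∀ n y, HasDerivAt (G n) (g' n (p y)) y := fun n y =>
    (((hc n).comp hpc).integral_hasStrictDerivAt 0 y).hasDerivAt.const_add _
  have := hasDerivAt_tsum hu hG (fun n y => hb n _ (hpm y)) (y₀ := 0)
    (by simpa [G] using h0) x
  rw [hpx x hx] at this
  refine this.hasDerivWithinAt.congr (fun y hy => ?_) ?_
  · exact tsum_congr fun n => (hGg n y hy).symm
  · exact tsum_congr fun n => (hGg n x hx).symm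

lemma hasDerivWithinAt_genFun₁ (hz : ∀ i, 0 ≤ z i)
    (hs : Summable fun k : ℕ => (k : ℝ) * ((k : ℝ) - 1) * z k)
    {x : ℝ} (hx : x ∈ Icc (0 : ℝ) 1) :
    HasDerivWithinAt (genFun₁ z) (genFun₂ z x) (Icc 0 1) x := by
  refine hasDerivWithinAt_tsum_Icc hs (g' := fun (k : ℕ) x =>
    (k : ℝ) * ((k : ℝ) - 1) * z k * x ^ (k - 2)) (fun k y => ?_) (fun k => by fun_prop)
    (fun k x hx => norm_mul_pow_le (mul_nonneg (cast_mul_sub_one_nonneg k) (hz k)) hx _)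
    (summable_of_ne_finset_zero (s := {0, 1}) fun k hk => ?_) hx
  · refine ((hasDerivAt_pow (k - 1) y).const_mul ((k : ℝ) * z k)).congr_deriv ?_
    rcases k with _ | k
    · simp
    · simp only [Nat.add_sub_cancel]; push_cast
      rw [show k - 1 = k + 1 - 2 by omega]; ring
  · have : k - 1 ≠ 0 := by
      simp only [Finset.mem_insert, Finset.mem_singleton, not_or] at hk; omega
    simp [this]

end GenFun

section GreatestRoot

variable {h : ℝ → ℝ} {ρ r : ℝ}

lemma exists_isGreatest_root (hc : ContinuousOn h (Icc 0 1)) (h0 : h 0 = 0) :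
    ∃ ρ, IsGreatest {r | r ∈ Icc (0 : ℝ) 1 ∧ h r = 0} ρ := by
  have hcl : IsClosed {r | r ∈ Icc (0 : ℝ) 1 ∧ h r = 0} :=
    hc.preimage_isClosed_of_isClosed isClosed_Icc (isClosed_singleton (x := (0 : ℝ)))
  exact (isCompact_Icc.of_isClosed_subset hcl fun r hr => hr.1).exists_isGreatest
    ⟨0, ⟨le_rfl, zero_le_one⟩, h0⟩

lemma lt_greatest_root (hc : ContinuousOn h (Icc 0 1)) (h1 : 0 ≤ h 1)
    (hρ : IsGreatest {r | r ∈ Icc (0 : ℝ) 1 ∧ h r = 0} ρ) (hr : r ∈ Icc (0 : ℝ) 1)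
    (hneg : h r < 0) : r < ρ := by
  obtain ⟨x, hx, hx0⟩ := intermediate_value_Icc hr.2 (hc.mono (Icc_subset_Icc_left hr.1))
    (show (0 : ℝ) ∈ Icc (h r) (h 1) from ⟨hneg.le, h1⟩)
  have hxr : r ≠ x := by rintro rfl; linarith
  exact (lt_of_le_of_ne hx.1 hxr).trans_le (hρ.2 ⟨⟨hr.1.trans hx.1, hx.2⟩, hx0⟩)

lemma nonpos_of_le_root (hconv : ConvexOn ℝ (Icc 0 1) h) (h0 : h 0 = 0)
    (hρ : ρ ∈ Icc (0 : ℝ) 1) (hρ0 : h ρ = 0) (hr : 0 ≤ r) (hrρ : r ≤ ρ) : h r ≤ 0 := by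
  have := hconv.le_max_of_mem_Icc (x := 0) (y := ρ) (z := r) ⟨le_rfl, zero_le_one⟩ hρ ⟨hr, hrρ⟩
  simpa [h0, hρ0] using this

lemma neg_of_lt_root (hconv : ConvexOn ℝ (Icc 0 1) h)
    (hneg : ∀ δ > 0, ∃ r ∈ Ioo 0 δ, h r < 0)
    (hρ : ρ ∈ Icc (0 : ℝ) 1) (hρ0 : h ρ = 0) (hr : 0 < r) (hrρ : r < ρ) : h r < 0 := by
  obtain ⟨q, hq, hq0⟩ := hneg r hr
  have := hconv.lt_right_of_left_lt (x := q) (y := ρ) (z := r)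
    ⟨hq.1.le, (hq.2.trans hrρ).le.trans hρ.2⟩ hρ
    (by rw [openSegment_eq_Ioo (hq.2.trans hrρ)]; exact ⟨hq.2, hrρ⟩)
  by_contra! hcon
  have := this (hq0.trans_le hcon)
  linarith

lemma pos_of_greatest_root_lt (hc : ContinuousOn h (Icc 0 1)) (h1 : 0 ≤ h 1)
    (hρ : IsGreatest {r | r ∈ Icc (0 : ℝ) 1 ∧ h r = 0} ρ) (hrρ : ρ < r) (hr1 : r ≤ 1) :
    0 < h r := by
  have hr : r ∈ Icc (0 : ℝ) 1 := ⟨hρ.1.1.1.trans hrρ.le, hr1⟩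
  rcases lt_trichotomy (h r) 0 with hlt | heq | hgt
  · exact absurd (lt_greatest_root hc h1 hρ hr hlt) hrρ.not_gt
  · exact absurd (hρ.2 ⟨hr, heq⟩) hrρ.not_ge
  · exact hgt

/-- The greatest root in `[0, 1]` of a convex function vanishing at `0` depends continuously on
parameters. -/
lemma continuousOn_greatest_root {h : ℝ → ℝ → ℝ} {ρ : ℝ → ℝ} {S : Set ℝ}
    (hc : ∀ c ∈ S, ContinuousOn (h c) (Icc 0 1))
    (hpar : ∀ r ∈ Icc (0 : ℝ) 1, ContinuousOn (fun c => h c r) S)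
    (hconv : ∀ c ∈ S, ConvexOn ℝ (Icc 0 1) (h c))
    (h0 : ∀ c ∈ S, h c 0 = 0) (h1 : ∀ c ∈ S, 0 ≤ h c 1)
    (hneg : ∀ c ∈ S, ∀ δ > 0, ∃ r ∈ Ioo 0 δ, h c r < 0)
    (hρ : ∀ c ∈ S, IsGreatest {r | r ∈ Icc (0 : ℝ) 1 ∧ h c r = 0} (ρ c)) :
    ContinuousOn ρ S := by
  intro c hcS
  have hρc := (hρ c hcS).1
  have hpos : 0 < ρ c := by
    obtain ⟨r, hr, hr0⟩ := hneg c hcS 1 one_pos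
    exact hr.1.trans (lt_greatest_root (hc c hcS) (h1 c hcS) (hρ c hcS) ⟨hr.1.le, hr.2.le⟩ hr0)
  refine tendsto_order.2 ⟨fun x hx => ?_, fun x hx => ?_⟩
  · obtain ⟨r, hr, hrρ⟩ := exists_between (max_lt hx hpos)
    have hr0 : 0 < r := (le_max_right _ _).trans_lt hr
    have hrI : r ∈ Icc (0 : ℝ) 1 := ⟨hr0.le, hrρ.le.trans hρc.1.2⟩
    have hn := neg_of_lt_root (hconv c hcS) (hneg c hcS) hρc.1 hρc.2 hr0 hrρ
    filter_upwards [(hpar r hrI c hcS).eventually_lt_const hn, self_mem_nhdsWithin] with d hd hdS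
    exact ((le_max_left _ _).trans_lt hr).trans
      (lt_greatest_root (hc d hdS) (h1 d hdS) (hρ d hdS) hrI hd)
  · rcases lt_or_ge 1 x with h1x | hx1
    · filter_upwards [self_mem_nhdsWithin] with d hdS
      exact (hρ d hdS).1.1.2.trans_lt h1x
    · have hxI : x ∈ Icc (0 : ℝ) 1 := ⟨hpos.le.trans hx.le, hx1⟩
      have hp := pos_of_greatest_root_lt (hc c hcS) (h1 c hcS) (hρ c hcS) hx hx1
      filter_upwards [(hpar x hxI c hcS).eventually_const_lt hp, self_mem_nhdsWithin] with d hd hdS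
      by_contra! hcon
      have := nonpos_of_le_root (hconv d hdS) (h0 d hdS) (hρ d hdS).1.1 (hρ d hdS).1.2 hxI.1 hcon
      linarith

end GreatestRoot

/-- `π` is a (sub)probability on `ℕ` with finite second moment, and `l < 1` is such that `π` stays
supercritical after the affine substitutions indexed by `c ∈ [l, 1]`. -/
structure IsSupercritical (π : ℕ → ℝ) (l : ℝ) : Prop where
  nonneg : ∀ i, 0 ≤ π i
  summable : Summable π
  mass_le : ∑' i, π i ≤ 1
  summable₁ : Summable fun k : ℕ => (k : ℝ) * π k
  summable₂ : Summable fun k : ℕ => (k : ℝ) * ((k : ℝ) - 1) * π k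
  exists_pos : ∃ k, 0 < k ∧ 0 < π k
  pos : 0 < l
  lt_one : l < 1
  lt_genFun₂ : ∀ c ∈ Icc l 1, genFun₁ π 1 < genFun₂ π c

/-- Slope of the affine substitution with value `c` at `1`. -/
noncomputable def slope₁ (π : ℕ → ℝ) (c : ℝ) : ℝ := genFun₁ π c / genFun₁ π 1

/-- Value at `0` of the affine substitution with value `c` at `1`. -/
noncomputable def shift₁ (π : ℕ → ℝ) (c : ℝ) : ℝ := c - slope₁ π c

/-- The function whose roots `r` are the solutions of `1 - r = ĝ(1 - r)`. -/
noncomputable def rootFun (π : ℕ → ℝ) (c r : ℝ) : ℝ :=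
  genFun₁ π (c - slope₁ π c * r) - (1 - r) * genFun₁ π c

/-- Greatest root of `rootFun`. -/
noncomputable def greatestRoot (π : ℕ → ℝ) (c : ℝ) : ℝ :=
  sSup {r | r ∈ Icc (0 : ℝ) 1 ∧ rootFun π c r = 0}

lemma exists_isSupercritical {π : ℕ → ℝ} (hπ0 : ∀ i, 0 ≤ π i) (hπ1 : ∑' i : ℕ, π i = 1)
    (hmom : Summable fun k : ℕ => (k : ℝ) ^ 2 * π k)
    (hsup : (∑' k : ℕ, (k : ℝ) * ((k : ℝ) - 1) * π k) > ∑' k : ℕ, (k : ℝ) * π k) :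
    ∃ l, IsSupercritical π l := by
  have hs1 : Summable fun k : ℕ => (k : ℝ) * π k := by
    refine Summable.of_nonneg_of_le (fun k => mul_nonneg k.cast_nonneg (hπ0 k)) (fun k => ?_) hmom
    refine mul_le_mul_of_nonneg_right ?_ (hπ0 k)
    exact_mod_cast Nat.le_self_pow two_ne_zero k
  have hs2 : Summable fun k : ℕ => (k : ℝ) * ((k : ℝ) - 1) * π k :=
    (hmom.sub hs1).congr fun k => by ring
  have hpos : ∃ k, 0 < k ∧ 0 < π k := by
    by_contra! hcon
    have h0 : ∀ k : ℕ, (k : ℝ) * π k = 0 := fun k => by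
      rcases Nat.eq_zero_or_pos k with rfl | hk
      · simp
      · rw [le_antisymm (hcon k hk) (hπ0 k), mul_zero]
    have h1 : ∀ k : ℕ, (k : ℝ) * ((k : ℝ) - 1) * π k = 0 := fun k => by
      rw [mul_right_comm, h0, zero_mul]
    simp [h0, h1] at hsup
  have hlt : genFun₁ π 1 < genFun₂ π 1 := by
    rw [genFun₁_one, genFun₂_one]; exact hsup
  have hev := (continuousOn_genFun₂ hπ0 hs2 1 ⟨zero_le_one, le_rfl⟩).eventually_const_lt hlt
  rw [eventually_nhdsWithin_iff, Metric.eventually_nhds_iff] at hev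
  obtain ⟨ε, hε, hev⟩ := hev
  refine ⟨max (1 / 2) (1 - ε / 2), hπ0, ?_, hπ1.le, hs1, hs2, hpos, by positivity,
    max_lt (by norm_num) (by linarith), fun c hc => hev ?_ ⟨?_, hc.2⟩⟩
  · by_contra hcon
    rw [tsum_eq_zero_of_not_summable hcon] at hπ1
    exact zero_ne_one hπ1
  · have := (le_max_right _ _).trans hc.1
    rw [Real.dist_eq, abs_sub_lt_iff]
    constructor <;> linarith [hc.2]
  · have := (le_max_left _ _).trans hc.1
    linarith

section AffineCompMoments

variable {π : ℕ → ℝ} {l a b : ℝ}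

lemma IsSupercritical.genFun₁_pos (h : IsSupercritical π l) {x : ℝ} (hx : 0 < x) (hx1 : x ≤ 1) :
    0 < genFun₁ π x := by
  obtain ⟨k, hk, hπk⟩ := h.exists_pos
  exact _root_.genFun₁_pos h.nonneg h.summable₁ hk hπk hx hx1

lemma IsSupercritical.genFun_le_one (h : IsSupercritical π l) {x : ℝ} (hx : x ∈ Icc (0 : ℝ) 1) :
    genFun π x ≤ 1 :=
  (Summable.tsum_le_tsum (fun k => mul_le_of_le_one_right (h.nonneg k) (pow_le_one₀ hx.1 hx.2))
    (h.summable.mul_pow_of_le_one h.nonneg hx.1 hx.2 id) h.summable).trans h.mass_le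

lemma IsSupercritical.hasSum_affineComp (h : IsSupercritical π l) (ha : 0 ≤ a) (hb : 0 ≤ b)
    (hab : a + b ≤ 1) : HasSum (affineComp π a b) (genFun π (a + b)) := by
  simpa using hasSum_affineComp_mul_pow h.nonneg h.summable ha hb zero_le_one (by simpa using hab)

lemma IsSupercritical.hasSum_mul_affineComp (h : IsSupercritical π l) (ha : 0 ≤ a) (hb : 0 ≤ b)
    (hab : a + b ≤ 1) :
    HasSum (fun i : ℕ => (i : ℝ) * affineComp π a b i) (b * genFun₁ π (a + b)) := by
  simpa using hasSum_affineComp₁ h.nonneg h.summable₁ ha hb zero_le_one (by simpa using hab)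

lemma IsSupercritical.emom_affineComp (h : IsSupercritical π l) (ha : 0 ≤ a) (hb : 0 ≤ b)
    (hab : a + b ≤ 1) : Emom (affineComp π a b) = b * genFun₁ π (a + b) :=
  (h.hasSum_mul_affineComp ha hb hab).tsum_eq

lemma IsSupercritical.qmom_affineComp (h : IsSupercritical π l) (ha : 0 ≤ a) (hb : 0 ≤ b)
    (hab : a + b ≤ 1) : Qmom (affineComp π a b) = b ^ 2 * genFun₂ π (a + b) :=
  (hasSum_affineComp₂ h.nonneg h.summable₂ ha hb hab).tsum_eq

lemma IsSupercritical.genFun₁_affineComp (h : IsSupercritical π l) (ha : 0 ≤ a) (hb : 0 ≤ b)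
    (hab : a + b ≤ 1) {s : ℝ} (hs : s ∈ Icc (0 : ℝ) 1) :
    genFun₁ (affineComp π a b) s = b * genFun₁ π (a + b * s) := by
  have h1 : a + b * s ≤ 1 := by nlinarith [hs.2]
  rw [← (hasSum_affineComp₁ h.nonneg h.summable₁ ha hb hs.1 h1).tsum_eq, genFun₁]
  exact tsum_congr fun k => by ring

end AffineCompMoments

namespace IsSupercritical

variable {π : ℕ → ℝ} {l c : ℝ}

lemma mem_unit (h : IsSupercritical π l) (hc : c ∈ Icc l 1) :
    c ∈ Icc (0 : ℝ) 1 := ⟨h.pos.le.trans hc.1, hc.2⟩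

lemma genFun₁_one_pos (h : IsSupercritical π l) : 0 < genFun₁ π 1 := h.genFun₁_pos one_pos le_rfl

lemma slope₁_pos (h : IsSupercritical π l) (hc : c ∈ Icc l 1) : 0 < slope₁ π c :=
  div_pos (h.genFun₁_pos (h.pos.trans_le hc.1) hc.2) h.genFun₁_one_pos

lemma hasDerivWithinAt_slope₁ (h : IsSupercritical π l) (hc : c ∈ Icc (0 : ℝ) 1) :
    HasDerivWithinAt (slope₁ π) (genFun₂ π c / genFun₁ π 1) (Icc 0 1) c :=
  (hasDerivWithinAt_genFun₁ h.nonneg h.summable₂ hc).div_const _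

lemma hasDerivWithinAt_shift₁ (h : IsSupercritical π l) (hc : c ∈ Icc (0 : ℝ) 1) :
    HasDerivWithinAt (shift₁ π) (1 - genFun₂ π c / genFun₁ π 1) (Icc 0 1) c :=
  (hasDerivWithinAt_id c _).sub (h.hasDerivWithinAt_slope₁ hc)

lemma shift₁_one (h : IsSupercritical π l) : shift₁ π 1 = 0 := by
  rw [shift₁, slope₁, div_self h.genFun₁_one_pos.ne', sub_self]

lemma slope₁_one (h : IsSupercritical π l) : slope₁ π 1 = 1 := div_self h.genFun₁_one_pos.ne'

lemma shift₁_add_slope₁ : shift₁ π c + slope₁ π c = c := by simp [shift₁]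

lemma one_lt_div (h : IsSupercritical π l) (hc : c ∈ Icc l 1) : 1 < genFun₂ π c / genFun₁ π 1 :=
  (one_lt_div₀ h.genFun₁_one_pos).2 (h.lt_genFun₂ c hc)

lemma shift₁_nonneg (h : IsSupercritical π l) (hc : c ∈ Icc l 1) : 0 ≤ shift₁ π c := by
  have hsub : Icc l 1 ⊆ Icc (0 : ℝ) 1 := Icc_subset_Icc_left h.pos.le
  have hanti : AntitoneOn (shift₁ π) (Icc l 1) := by
    refine antitoneOn_of_hasDerivWithinAt_nonpos (convex_Icc l 1)
      (fun x hx => (h.hasDerivWithinAt_shift₁ (hsub hx)).continuousWithinAt.mono hsub)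
      (fun x hx => (h.hasDerivWithinAt_shift₁ (hsub (interior_subset hx))).mono
        (interior_subset.trans hsub)) (fun x hx => ?_)
    linarith [h.one_lt_div (interior_subset hx)]
  have := hanti hc ⟨h.lt_one.le, le_rfl⟩ hc.2
  rwa [h.shift₁_one] at this

lemma shift₁_lt_one (h : IsSupercritical π l) (hc : c ∈ Icc l 1) : shift₁ π c < 1 := by
  have := h.slope₁_pos hc
  rw [shift₁]; linarith [hc.2]

lemma sub_slope_mul_mem (h : IsSupercritical π l) (hc : c ∈ Icc l 1)
    {r : ℝ} (hr : r ∈ Icc (0 : ℝ) 1) :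
    c - slope₁ π c * r ∈ Icc (0 : ℝ) 1 := by
  have h1 := h.slope₁_pos hc
  have h2 := h.shift₁_nonneg hc
  rw [shift₁] at h2
  constructor
  · nlinarith [hr.2]
  · nlinarith [hr.1, hc.2]

lemma continuousOn_rootFun (h : IsSupercritical π l) (hc : c ∈ Icc l 1) :
    ContinuousOn (rootFun π c) (Icc 0 1) := by
  refine ContinuousOn.sub ?_ (by fun_prop)
  exact (continuousOn_genFun₁ h.nonneg h.summable₁).comp (by fun_prop)
    fun r hr => h.sub_slope_mul_mem hc hr

lemma continuousOn_genFun₁' (h : IsSupercritical π l) : ContinuousOn (genFun₁ π) (Icc l 1) :=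
  (continuousOn_genFun₁ h.nonneg h.summable₁).mono (Icc_subset_Icc_left h.pos.le)

lemma continuousOn_rootFun_left (h : IsSupercritical π l) {r : ℝ} (hr : r ∈ Icc (0 : ℝ) 1) :
    ContinuousOn (fun c => rootFun π c r) (Icc l 1) := by
  have h1 := h.continuousOn_genFun₁'
  have h2 : ContinuousOn (slope₁ π) (Icc l 1) := h1.div_const _
  refine ContinuousOn.sub ?_ (continuousOn_const.mul h1)
  exact (continuousOn_genFun₁ h.nonneg h.summable₁).comp
    (continuousOn_id.sub (h2.mul continuousOn_const)) fun c hc => h.sub_slope_mul_mem hc hr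

lemma convexOn_rootFun (h : IsSupercritical π l) (hc : c ∈ Icc l 1) :
    ConvexOn ℝ (Icc 0 1) (rootFun π c) := by
  refine ⟨convex_Icc 0 1, fun x hx y hy a b ha hb hab => ?_⟩
  have := (convexOn_genFun₁ h.nonneg h.summable₁).2 (h.sub_slope_mul_mem hc hx)
    (h.sub_slope_mul_mem hc hy) ha hb hab
  simp only [smul_eq_mul, rootFun] at this ⊢
  have he : a * (c - slope₁ π c * x) + b * (c - slope₁ π c * y)
      = c - slope₁ π c * (a * x + b * y) := by
    linear_combination c * hab
  rw [he] at this
  have he2 : (1 - (a * x + b * y)) * genFun₁ π c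
      = a * ((1 - x) * genFun₁ π c) + b * ((1 - y) * genFun₁ π c) := by
    linear_combination (-genFun₁ π c) * hab
  rw [he2]
  linarith

lemma rootFun_zero : rootFun π c 0 = 0 := by simp [rootFun]

lemma rootFun_one_nonneg (h : IsSupercritical π l) (hc : c ∈ Icc l 1) : 0 ≤ rootFun π c 1 := by
  simpa [rootFun] using genFun₁_nonneg h.nonneg
    (h.sub_slope_mul_mem hc ⟨zero_le_one, le_rfl⟩).1

lemma exists_rootFun_neg (h : IsSupercritical π l) (hc : c ∈ Icc l 1) {δ : ℝ} (hδ : 0 < δ) :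
    ∃ r ∈ Ioo 0 δ, rootFun π c r < 0 := by
  have hd : HasDerivWithinAt (rootFun π c)
      (genFun₂ π (c - slope₁ π c * 0) * (-(slope₁ π c * 1)) - (-1) * genFun₁ π c)
      (Icc 0 1) 0 := by
    have h1 := hasDerivWithinAt_genFun₁ h.nonneg h.summable₂
      (h.sub_slope_mul_mem hc (r := 0) ⟨le_rfl, zero_le_one⟩)
    have h2 : HasDerivWithinAt (fun r : ℝ => c - slope₁ π c * r) (-(slope₁ π c * 1))
      (Icc 0 1) 0 := ((hasDerivWithinAt_id (0 : ℝ) _).const_mul _).const_sub c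
    have h3 := h1.comp (0 : ℝ) h2 fun r hr => h.sub_slope_mul_mem hc hr
    exact h3.sub (((hasDerivWithinAt_id (0 : ℝ) _).const_sub 1).mul_const _)
  have hneg : genFun₂ π (c - slope₁ π c * 0) * (-(slope₁ π c * 1)) - (-1) * genFun₁ π c < 0 := by
    have h1 := h.one_lt_div hc
    have h2 := h.genFun₁_pos (h.pos.trans_le hc.1) hc.2
    have : genFun₂ π (c - slope₁ π c * 0) * (-(slope₁ π c * 1)) - (-1) * genFun₁ π c
      = -(genFun₁ π c * (genFun₂ π c / genFun₁ π 1 - 1)) := by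
      simp only [slope₁, mul_zero, sub_zero]; ring
    rw [this]
    nlinarith
  have hd' := hd.mono_of_mem_nhdsWithin (Icc_mem_nhdsGT one_pos)
  rw [hasDerivWithinAt_iff_tendsto_slope' self_notMem_Ioi] at hd'
  obtain ⟨r, hr, hrδ⟩ := ((hd'.eventually_lt_const hneg).and (Ioo_mem_nhdsGT hδ)).exists
  refine ⟨r, hrδ, ?_⟩
  rw [slope_def_field, rootFun_zero, sub_zero, sub_zero] at hr
  exact (div_neg_iff.1 hr).resolve_left (fun hcon => by linarith [hcon.2, hrδ.1]) |>.1

lemma isGreatest_greatestRoot (h : IsSupercritical π l) (hc : c ∈ Icc l 1) :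
    IsGreatest {r | r ∈ Icc (0 : ℝ) 1 ∧ rootFun π c r = 0} (greatestRoot π c) := by
  obtain ⟨ρ, hρ⟩ := exists_isGreatest_root (h.continuousOn_rootFun hc) rootFun_zero
  rwa [greatestRoot, hρ.csSup_eq]

lemma greatestRoot_pos (h : IsSupercritical π l) (hc : c ∈ Icc l 1) : 0 < greatestRoot π c := by
  obtain ⟨r, hr, hr0⟩ := h.exists_rootFun_neg hc one_pos
  exact hr.1.trans (lt_greatest_root (h.continuousOn_rootFun hc) (h.rootFun_one_nonneg hc)
    (h.isGreatest_greatestRoot hc) ⟨hr.1.le, hr.2.le⟩ hr0)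

lemma continuousOn_greatestRoot (h : IsSupercritical π l) :
    ContinuousOn (greatestRoot π) (Icc l 1) :=
  continuousOn_greatest_root (fun _ hc => h.continuousOn_rootFun hc)
    (fun _ hr => h.continuousOn_rootFun_left hr) (fun _ hc => h.convexOn_rootFun hc)
    (fun _ _ => rootFun_zero) (fun _ hc => h.rootFun_one_nonneg hc)
    (fun _ hc _ hδ => h.exists_rootFun_neg hc hδ) (fun _ hc => h.isGreatest_greatestRoot hc)

lemma add_le_one (hc : c ∈ Icc l 1) : shift₁ π c + slope₁ π c ≤ 1 :=
  shift₁_add_slope₁.trans_le hc.2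

lemma emom_eq (h : IsSupercritical π l) (hc : c ∈ Icc l 1) :
    Emom (affineComp π (shift₁ π c) (slope₁ π c)) = slope₁ π c * genFun₁ π c := by
  rw [h.emom_affineComp (h.shift₁_nonneg hc) (h.slope₁_pos hc).le (add_le_one hc),
    shift₁_add_slope₁]

lemma qmom_eq (h : IsSupercritical π l) (hc : c ∈ Icc l 1) :
    Qmom (affineComp π (shift₁ π c) (slope₁ π c)) = slope₁ π c ^ 2 * genFun₂ π c := by
  rw [h.qmom_affineComp (h.shift₁_nonneg hc) (h.slope₁_pos hc).le (add_le_one hc),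
    shift₁_add_slope₁]

lemma emom_pos (h : IsSupercritical π l) (hc : c ∈ Icc l 1) :
    0 < Emom (affineComp π (shift₁ π c) (slope₁ π c)) := by
  rw [h.emom_eq hc]
  exact mul_pos (h.slope₁_pos hc) (h.genFun₁_pos (h.pos.trans_le hc.1) hc.2)

lemma setOf_ghat_eq (h : IsSupercritical π l) (hc : c ∈ Icc l 1) :
    {r | r ∈ Icc (0 : ℝ) 1 ∧ 1 - r = ghat (affineComp π (shift₁ π c) (slope₁ π c)) (1 - r)}
      = {r | r ∈ Icc (0 : ℝ) 1 ∧ rootFun π c r = 0} := by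
  ext r
  simp only [mem_ofPred_eq, and_congr_right_iff]
  intro hr
  have hb := h.slope₁_pos hc
  have hf := h.genFun₁_pos (h.pos.trans_le hc.1) hc.2
  have hg : ghat (affineComp π (shift₁ π c) (slope₁ π c)) (1 - r)
      = genFun₁ π (c - slope₁ π c * r) / genFun₁ π c := by
    change genFun₁ _ _ / _ = _
    rw [h.genFun₁_affineComp (h.shift₁_nonneg hc) hb.le (add_le_one hc)
      ⟨by linarith [hr.2], by linarith [hr.1]⟩, h.emom_eq hc, mul_div_mul_left _ _ hb.ne']
    congr 2
    rw [shift₁]; ring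
  rw [hg, eq_div_iff hf.ne', rootFun, sub_eq_zero, eq_comm]

end IsSupercritical

namespace IsSupercritical

open Filter Topology

variable {π : ℕ → ℝ} {l : ℝ}

/-- A clock function `T` with derivative `-ρ` times `genFun₁` on `[l, 1]`, and its inverse. -/
lemma exists_clock (h : IsSupercritical π l) : ∃ T c : ℝ → ℝ,
    (∀ x ∈ Icc l 1, HasDerivAt T (-(greatestRoot π x * genFun₁ π x)) x) ∧
    (∀ t, T (c t) = t) ∧ (∀ x, c (T x) = x) ∧ Continuous c ∧ StrictAnti T ∧ T 1 = 0 := by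
  have hl := h.lt_one.le
  let w : ℝ → ℝ := IccExtend hl fun x : Icc l 1 => greatestRoot π x * genFun₁ π x
  have hw0 : ContinuousOn (fun x => greatestRoot π x * genFun₁ π x) (Icc l 1) :=
    h.continuousOn_greatestRoot.mul h.continuousOn_genFun₁'
  have hwc : Continuous w := (continuousOn_iff_continuous_domRestrict.1 hw0).Icc_extend'
  have hpos : ∀ x ∈ Icc l 1, 0 < greatestRoot π x * genFun₁ π x := fun x hx =>
    mul_pos (h.greatestRoot_pos hx) (h.genFun₁_pos (h.pos.trans_le hx.1) hx.2)
  obtain ⟨x₀, hx₀, hmin⟩ := isCompact_Icc.exists_isMinOn (nonempty_Icc.2 hl) hw0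
  set δ := greatestRoot π x₀ * genFun₁ π x₀ with hδ
  have hδ0 : 0 < δ := hpos x₀ hx₀
  have hwδ : ∀ x, δ ≤ w x := fun x => hmin (projIcc l 1 hl x).2
  let K : ℝ → ℝ := fun x => ∫ u in (1 : ℝ)..x, w u
  have hK : ∀ x, HasDerivAt K (w x) x := fun x => (hwc.integral_hasStrictDerivAt 1 x).hasDerivAt
  have hK1 : K 1 = 0 := intervalIntegral.integral_same
  have hKc : Continuous K := continuous_iff_continuousAt.2 fun x => (hK x).continuousAt
  have hKm : StrictMono K := strictMono_of_hasDerivAt_pos hK fun x => hδ0.trans_le (hwδ x)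
  have hmono : Monotone fun x => K x - δ * x :=
    monotone_of_hasDerivAt_nonneg (f' := fun x => w x - δ * 1)
      (fun x => (hK x).sub ((hasDerivAt_id x).const_mul δ))
      fun x => by simpa using hwδ x
  have htop : Tendsto K atTop atTop := by
    refine tendsto_atTop_mono' _ ?_ (tendsto_atTop_add_const_right atTop (-δ)
      (tendsto_id.const_mul_atTop hδ0))
    filter_upwards [eventually_ge_atTop 1] with x hx
    have := hmono hx
    simp only [hK1, id] at this ⊢
    linarith
  have hbot : Tendsto K atBot atBot := by
    refine tendsto_atBot_mono' _ ?_ (tendsto_atBot_add_const_right atBot (-δ)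
      (tendsto_id.const_mul_atBot hδ0))
    filter_upwards [eventually_le_atBot 1] with x hx
    have := hmono hx
    simp only [hK1, id] at this ⊢
    linarith
  let e := hKm.orderIsoOfSurjective K (hKc.surjective htop hbot)
  refine ⟨fun x => -K x, fun t => e.symm (-t), fun x hx => ?_, fun t => ?_, fun x => ?_, ?_,
    fun x y hxy => neg_lt_neg (hKm hxy), ?_⟩
  · have := (hK x).neg
    rwa [show w x = _ from IccExtend_of_mem hl _ hx] at this
  · change -(e (e.symm (-t))) = t
    rw [OrderIso.apply_symm_apply, neg_neg]
  · change e.symm (-(-e x)) = x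
    rw [neg_neg, OrderIso.symm_apply_apply]
  · exact e.symm.continuous.comp continuous_neg
  · simp [hK1]

end IsSupercritical

lemma fS_eq (z : ℕ → ℝ) (ρ : ℝ) (i : ℕ) :
    fS z ρ i = -(1 / ρ * (Qmom z / Emom z) / Emom z) * (i * z i)
      + (1 / ρ * (Qmom z / Emom z - 1) / Emom z) * ((i + 1) * z (i + 1)) := by
  rw [fS]; ring

namespace IsSupercritical

variable {π : ℕ → ℝ} {l : ℝ}

lemma abs_le_one (h : IsSupercritical π l) (i : ℕ) : |π i| ≤ 1 := by
  rw [abs_of_nonneg (h.nonneg i)]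
  exact (h.summable.le_tsum i fun j _ => h.nonneg j).trans h.mass_le

lemma isSolS (h : IsSupercritical π l) {T c : ℝ → ℝ}
    (hT : ∀ x ∈ Icc l 1, HasDerivAt T (-(greatestRoot π x * genFun₁ π x)) x)
    (hTc : ∀ t, T (c t) = t) (hc : Continuous c)
    (hc1 : c 0 = 1) (hmem : ∀ t ∈ Ico 0 (T l), c t ∈ Icc l 1) :
    IsSolS π (T l) (fun i t => affineComp π (shift₁ π (c t)) (slope₁ π (c t)) i)
      (fun t => greatestRoot π (c t)) := by
  refine ⟨fun i => ?_, fun t ht => ?_⟩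
  · simp only [hc1, h.shift₁_one, h.slope₁_one, affineComp_zero_one]
  have hx := hmem t ht
  have ha := h.shift₁_nonneg hx
  have hb := h.slope₁_pos hx
  have hab := add_le_one (π := π) hx
  refine ⟨fun i => affineComp_nonneg h.nonneg ha hb.le i,
    (h.hasSum_affineComp ha hb.le hab).summable, ?_,
    (h.hasSum_mul_affineComp ha hb.le hab).summable, h.emom_pos hx,
    (hasSum_affineComp₂ h.nonneg h.summable₂ ha hb.le hab).summable, ?_, fun i => ?_⟩
  · change ∑' i, affineComp π _ _ i ≤ 1
    rw [(h.hasSum_affineComp ha hb.le hab).tsum_eq]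
    exact h.genFun_le_one ⟨by positivity, hab⟩
  · change IsGreatest {r | r ∈ Icc (0 : ℝ) 1 ∧
      1 - r = ghat (affineComp π (shift₁ π (c t)) (slope₁ π (c t))) (1 - r)} _
    rw [h.setOf_ghat_eq hx]
    exact h.isGreatest_greatestRoot hx
  · change HasDerivWithinAt _ (fS (affineComp π (shift₁ π (c t)) (slope₁ π (c t))) _ i) _ _
    have hp := h.genFun₁_pos (h.pos.trans_le hx.1) hx.2
    have hP := h.genFun₁_one_pos
    have hρ := h.greatestRoot_pos hx
    have hcd : HasDerivAt c (-(greatestRoot π (c t) * genFun₁ π (c t)))⁻¹ t :=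
      HasDerivAt.of_local_left_inverse hc.continuousAt (hT _ hx)
        (neg_ne_zero.2 (mul_pos hρ hp).ne') (Filter.Eventually.of_forall hTc)
    have hmaps : MapsTo c (Ico 0 (T l)) (Icc 0 1) := fun u hu => h.mem_unit (hmem u hu)
    have hsh := (h.hasDerivWithinAt_shift₁ (h.mem_unit hx)).comp t hcd.hasDerivWithinAt hmaps
    have hsl := (h.hasDerivWithinAt_slope₁ (h.mem_unit hx)).comp t hcd.hasDerivWithinAt hmaps
    have htc := (hasDerivAt_taylorCoeff h.abs_le_one i (x := shift₁ π (c t))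
      (by rw [abs_of_nonneg ha]; exact h.shift₁_lt_one hx)).comp_hasDerivWithinAt t hsh
    refine (htc.mul (hsl.pow i)).congr_deriv ?_
    rw [fS_eq, h.emom_eq hx, h.qmom_eq hx]
    have hpb : genFun₁ π (c t) = slope₁ π (c t) * genFun₁ π 1 := by
      rw [slope₁, div_mul_cancel₀ _ hP.ne']
    simp only [Pi.pow_apply, Function.comp_apply, affineComp]
    generalize slope₁ π (c t) = b at *
    rw [hpb]
    generalize greatestRoot π (c t) = ρ at *
    generalize genFun₁ π 1 = P at *
    have h1 := hb.ne'
    have h2 := hP.ne'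
    have h3 := hρ.ne'
    rcases i with _ | i
    · simp only [Nat.cast_zero]
      field_simp
      ring
    · simp only [Nat.add_sub_cancel]
      push_cast
      field_simp
      ring

end IsSupercritical

section Primitive

open MeasureTheory Filter Topology

variable {a b C : ℝ} {τ τ' G G' φ : ℝ → ℝ}

lemma intervalIntegrable_of_abs_le_deriv (hab : a ≤ b) (hτ : ContinuousOn τ (Icc a b))
    (hτd : ∀ t ∈ Ioo a b, HasDerivAt τ (τ' t) t) (hτ0 : ∀ t ∈ Ioo a b, 0 ≤ τ' t)
    (hGd : ∀ t ∈ Ioo a b, HasDerivAt G (G' t) t) (hG : ∀ t ∈ Ioo a b, |G' t| ≤ C * τ' t) :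
    IntervalIntegrable τ' volume a b ∧ IntervalIntegrable G' volume a b := by
  have h1 : IntervalIntegrable τ' volume a b :=
    intervalIntegral.intervalIntegrable_deriv_of_nonneg (g := τ) (by rwa [uIcc_of_le hab])
      (by simpa [hab] using hτd) (by simpa [hab] using hτ0)
  refine ⟨h1, ?_⟩
  rw [intervalIntegrable_iff_integrableOn_Ioo_of_le hab] at h1 ⊢
  have hae : deriv G =ᵐ[volume.restrict (Ioo a b)] G' :=
    (ae_restrict_iff' measurableSet_Ioo).2 (Eventually.of_forall fun t ht => (hGd t ht).deriv)
  exact Integrable.mono' (h1.const_mul C)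
    ((measurable_deriv G).aestronglyMeasurable.congr hae)
    ((ae_restrict_iff' measurableSet_Ioo).2 (Eventually.of_forall hG))

/-- A product of a continuous function with a derivative controlled by the derivative of a
monotone function has a primitive, in the sense of derivatives at *every* interior point. -/
lemma exists_primitive_mul_deriv (hab : a ≤ b) (hτ : ContinuousOn τ (Icc a b))
    (hτd : ∀ t ∈ Ioo a b, HasDerivAt τ (τ' t) t) (hτ0 : ∀ t ∈ Ioo a b, 0 ≤ τ' t)
    (hGc : ContinuousOn G (Icc a b)) (hGd : ∀ t ∈ Ioo a b, HasDerivAt G (G' t) t)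
    (hG : ∀ t ∈ Ioo a b, |G' t| ≤ C * τ' t) (hφ : ContinuousOn φ (Icc a b)) :
    ∃ I : ℝ → ℝ, ContinuousOn I (Icc a b) ∧ I a = 0 ∧
      ∀ t ∈ Ioo a b, HasDerivAt I (φ t * G' t) t := by
  obtain ⟨hτi, hGi⟩ := intervalIntegrable_of_abs_le_deriv hab hτ hτd hτ0 hGd hG
  have hφGi : IntervalIntegrable (fun t => φ t * G' t) volume a b :=
    hGi.continuousOn_mul (by rwa [uIcc_of_le hab])
  refine ⟨fun t => ∫ u in a..t, φ u * G' u, ?_, intervalIntegral.integral_same, fun t ht => ?_⟩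
  · have := intervalIntegral.continuousOn_primitive_interval (μ := volume)
      ((intervalIntegrable_iff').1 hφGi)
    rwa [uIcc_of_le hab] at this
  have hsub : ∀ {x y}, x ∈ Icc a b → y ∈ Icc a b → uIcc x y ⊆ uIcc a b := fun hx hy => by
    rw [uIcc_of_le hab]; exact uIcc_subset_Icc hx hy
  have ha : a ∈ Icc a b := ⟨le_rfl, hab⟩
  have ht' := Ioo_subset_Icc_self ht
  have hle_of_int : ∀ {H H' : ℝ → ℝ}, ContinuousOn H (Icc a b) →
      (∀ t ∈ Ioo a b, HasDerivAt H (H' t) t) → IntervalIntegrable H' volume a b →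
      ∀ {x y}, x ∈ Icc a b → y ∈ Icc a b → ∫ u in x..y, H' u = H y - H x := by
    intro H H' hc hd hi x y hx hy
    wlog hxy : x ≤ y generalizing x y
    · rw [intervalIntegral.integral_symm, this hy hx (le_of_not_ge hxy), neg_sub]
    exact intervalIntegral.integral_eq_sub_of_hasDerivAt_of_le hxy
      (hc.mono (Icc_subset_Icc hx.1 hy.2))
      (fun u hu => hd u ⟨hx.1.trans_lt hu.1, hu.2.trans_le hy.2⟩)
      (hi.mono_set (hsub hx hy))
  have key : ∀ y ∈ Icc a b, (∫ u in a..y, φ u * G' u) - φ t * G y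
      - ((∫ u in a..t, φ u * G' u) - φ t * G t) = ∫ u in t..y, (φ u - φ t) * G' u := by
    intro y hy
    have e1 := intervalIntegral.integral_interval_sub_left
      (hφGi.mono_set (hsub ha hy)) (hφGi.mono_set (hsub ha ht'))
    have e2 := hle_of_int hGc hGd hGi ht' hy
    simp only [sub_mul]
    rw [intervalIntegral.integral_sub (hφGi.mono_set (hsub ht' hy))
      ((hGi.const_mul (φ t)).mono_set (hsub ht' hy)), intervalIntegral.integral_const_mul, e2, ← e1]
    ring
  have hJ : HasDerivAt (fun y => (∫ u in a..y, φ u * G' u) - φ t * G y) 0 t := by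
    rw [hasDerivAt_iff_isLittleO]
    have hO := (hτd t ht).isBigO_sub
    have ho : (fun y => (∫ u in a..y, φ u * G' u) - φ t * G y
        - ((∫ u in a..t, φ u * G' u) - φ t * G t) - (y - t) • (0 : ℝ))
        =o[𝓝 t] fun y => τ y - τ t := by
      refine Asymptotics.isLittleO_iff.2 fun ε hε => ?_
      obtain ⟨η, hη, hηC⟩ : ∃ η > 0, η * C ≤ ε :=
        ⟨ε / (|C| + 1), by positivity, by
          rw [div_mul_eq_mul_div, div_le_iff₀ (by positivity)]
          nlinarith [le_abs_self C]⟩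
      have hφt : ContinuousAt φ t := hφ.continuousAt (Icc_mem_nhds ht.1 ht.2)
      obtain ⟨δ, hδ, hball⟩ := Metric.mem_nhds_iff.1 (inter_mem
        (hφt (Metric.closedBall_mem_nhds (φ t) hη)) (Ioo_mem_nhds ht.1 ht.2))
      filter_upwards [Metric.ball_mem_nhds t hδ] with y hy
      have hy' := Ioo_subset_Icc_self (hball hy).2
      rw [smul_zero, sub_zero, key y hy', ← hle_of_int hτ hτd hτi ht' hy']
      have hseg : uIoc t y ⊆ Metric.ball t δ := uIoc_subset_uIcc.trans
        ((convex_ball t δ).ordConnected.uIcc_subset (Metric.mem_ball_self hδ) hy)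
      calc ‖∫ u in t..y, (φ u - φ t) * G' u‖ ≤ |∫ u in t..y, ε * τ' u| := by
            refine intervalIntegral.norm_integral_le_abs_of_norm_le
              ((ae_restrict_iff' measurableSet_uIoc).2 (Eventually.of_forall fun u hu => ?_))
              ((hτi.const_mul ε).mono_set (hsub ht' hy'))
            have hu' := hball (hseg hu)
            have h1 : |φ u - φ t| ≤ η := hu'.1
            rw [norm_mul, Real.norm_eq_abs, Real.norm_eq_abs]
            calc |φ u - φ t| * |G' u| ≤ η * (C * τ' u) :=
                  mul_le_mul h1 (hG u hu'.2) (abs_nonneg _) hη.le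
              _ = η * C * τ' u := by ring
              _ ≤ ε * τ' u := mul_le_mul_of_nonneg_right hηC (hτ0 u hu'.2)
        _ = ε * ‖∫ u in t..y, τ' u‖ := by
            rw [intervalIntegral.integral_const_mul, abs_mul, abs_of_pos hε, Real.norm_eq_abs]
    exact ho.trans_isBigO hO
  exact ((hJ.add ((hGd t ht).const_mul (φ t))).congr_deriv (zero_add _)).congr_of_eventuallyEq
    (Eventually.of_forall fun y => (sub_add_cancel _ _).symm)

end Primitive

open Filter Topology

/-- If the largest solution of the fixed point equation is positive, then `E ≤ Q`. -/
lemma emom_le_qmom {z : ℕ → ℝ} (hz : ∀ i, 0 ≤ z i) (hs₁ : Summable fun k : ℕ => (k : ℝ) * z k)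
    (hs₂ : Summable fun k : ℕ => (k : ℝ) * ((k : ℝ) - 1) * z k) {ρ : ℝ} (hρ : 0 < ρ) (hρ1 : ρ ≤ 1)
    (hroot : genFun₁ z (1 - ρ) = (1 - ρ) * Emom z) : Emom z ≤ Qmom z := by
  have h1 : Emom z - ρ * Qmom z ≤ genFun₁ z (1 - ρ) := by
    refine hasSum_le (fun k => ?_) (hs₁.hasSum.sub (hs₂.hasSum.mul_left ρ))
      (summable_first hz hs₁ ⟨by linarith, by linarith⟩).hasSum
    rcases k with _ | k
    · simp
    have hb := one_add_mul_le_pow (a := -ρ) (by linarith) k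
    have hk : (0 : ℝ) ≤ ((k + 1 : ℕ) : ℝ) * z (k + 1) := mul_nonneg (Nat.cast_nonneg _) (hz _)
    rw [Nat.add_sub_cancel, sub_eq_add_neg 1 ρ]
    refine le_trans (le_of_eq ?_) (mul_le_mul_of_nonneg_left hb hk)
    push_cast
    ring
  rw [hroot] at h1
  nlinarith

/-- Uniqueness of power series coefficients for summable sequences. -/
lemma eq_zero_of_tsum_mul_pow_eq_zero {d : ℕ → ℝ} (hd : Summable d)
    (h : ∀ s ∈ Ioo (0 : ℝ) 1, ∑' i, d i * s ^ i = 0) (n : ℕ) : d n = 0 := by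
  induction n using Nat.strong_induction_on with
  | _ n ih =>
  have hshift : Summable fun i => |d (i + n)| := (summable_nat_add_iff n).2 hd.abs
  have hsum : ∀ s ∈ Icc (0 : ℝ) 1, Summable fun i => d i * s ^ i := fun s hs =>
    .of_norm_bounded hd.abs fun i => by
      rw [norm_mul, norm_pow, Real.norm_eq_abs, Real.norm_of_nonneg hs.1]
      exact mul_le_of_le_one_right (abs_nonneg _) (pow_le_one₀ hs.1 hs.2)
  have hcont : ContinuousOn (fun s : ℝ => ∑' i, d (i + n) * s ^ i) (Icc 0 1) :=
    continuousOn_tsum (fun i => by fun_prop) hshift fun i s hs => by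
      rw [norm_mul, norm_pow, Real.norm_eq_abs, Real.norm_of_nonneg hs.1]
      exact mul_le_of_le_one_right (abs_nonneg _) (pow_le_one₀ hs.1 hs.2)
  have hzero : ∀ s ∈ Ioo (0 : ℝ) 1, ∑' i, d (i + n) * s ^ i = 0 := by
    intro s hs
    have h1 := (hsum s ⟨hs.1.le, hs.2.le⟩).sum_add_tsum_nat_add n
    rw [h s hs, Finset.sum_eq_zero fun i hi => by rw [ih i (Finset.mem_range.1 hi), zero_mul],
      zero_add] at h1
    have h2 : ∑' i, d (i + n) * s ^ (i + n) = s ^ n * ∑' i, d (i + n) * s ^ i := by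
      rw [← tsum_mul_left]
      exact tsum_congr fun i => by ring
    rw [h2] at h1
    exact (mul_eq_zero.1 h1).resolve_left (pow_pos hs.1 n).ne'
  have hlim := (hcont 0 ⟨le_rfl, zero_le_one⟩).mono_left
    (nhdsWithin_mono (0 : ℝ) (Ioo_subset_Icc_self (a := (0 : ℝ)) (b := 1)))
  have hne : (𝓝[Ioo (0 : ℝ) 1] 0).NeBot := by
    rw [nhdsWithin_Ioo_eq_nhdsGT one_pos]; infer_instance
  have h0 := tendsto_nhds_unique (hlim.congr' (eventually_nhdsWithin_of_forall hzero))
    tendsto_const_nhds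
  beta_reduce at h0
  rw [tsum_eq_single 0 fun i hi => by simp [hi]] at h0
  simpa using h0

lemma monotoneOn_Icc_of_hasDerivAt {f f' : ℝ → ℝ} {a b : ℝ} (hc : ContinuousOn f (Icc a b))
    (hd : ∀ t ∈ Ioo a b, HasDerivAt f (f' t) t) (hf' : ∀ t ∈ Ioo a b, 0 ≤ f' t) :
    MonotoneOn f (Icc a b) := by
  refine monotoneOn_of_hasDerivWithinAt_nonneg (convex_Icc a b) (f' := f') hc ?_ ?_ <;>
    rw [interior_Icc]
  exacts [fun t ht => (hd t ht).hasDerivWithinAt, hf']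

lemma antitoneOn_Icc_of_hasDerivAt {f f' : ℝ → ℝ} {a b : ℝ} (hc : ContinuousOn f (Icc a b))
    (hd : ∀ t ∈ Ioo a b, HasDerivAt f (f' t) t) (hf' : ∀ t ∈ Ioo a b, f' t ≤ 0) :
    AntitoneOn f (Icc a b) := by
  refine antitoneOn_of_hasDerivWithinAt_nonpos (convex_Icc a b) (f' := f') hc ?_ ?_ <;>
    rw [interior_Icc]
  exacts [fun t ht => (hd t ht).hasDerivWithinAt, hf']

section Flow

variable {z : ℕ → ℝ → ℝ} {A B α β τ τ' : ℝ → ℝ} {a b C : ℝ}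

/-- The generating function of a solution of the linear system is transported along the
characteristics, which solve the affine equation with coefficients `A` and `-B`. -/
lemma genFun_flow (hab : a ≤ b) (hz : ∀ i, ContinuousOn (z i) (Icc a b))
    (hz0 : ∀ i, ∀ t ∈ Icc a b, 0 ≤ z i t) (hz1 : ∀ i, ∀ t ∈ Icc a b, z i t ≤ 1)
    (hsa : Summable fun i => z i a) (hsb : Summable fun i => z i b)
    (hd : ∀ i, ∀ t ∈ Ioo a b,
      HasDerivAt (z i) (-(A t) * (i * z i t) + B t * ((i + 1) * z (i + 1) t)) t)
    (hα : ContinuousOn α (Icc a b)) (hβ : ContinuousOn β (Icc a b))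
    (hαd : ∀ t ∈ Ioo a b, HasDerivAt α (B t * β t) t)
    (hβd : ∀ t ∈ Ioo a b, HasDerivAt β (-(A t) * β t) t)
    (hβ0 : ∀ t ∈ Icc a b, 0 < β t) (hB : ∀ t ∈ Ioo a b, 0 ≤ B t)
    (hBA : ∀ t ∈ Ioo a b, B t ≤ A t)
    (hτ : ContinuousOn τ (Icc a b)) (hτd : ∀ t ∈ Ioo a b, HasDerivAt τ (τ' t) t)
    (hBτ : ∀ t ∈ Ioo a b, B t ≤ C * τ' t) {s : ℝ} (hs : s ∈ Ioo (0 : ℝ) 1) :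
    genFun (fun i => z i b) s = genFun (fun i => z i a) ((α b + β b * s - α a) / β a) := by
  have hβm : AntitoneOn β (Icc a b) := antitoneOn_Icc_of_hasDerivAt hβ hβd fun t ht => by
    nlinarith [hB t ht, hBA t ht, hβ0 t (Ioo_subset_Icc_self ht)]
  have hαm : MonotoneOn α (Icc a b) := monotoneOn_Icc_of_hasDerivAt hα hαd fun t ht =>
    mul_nonneg (hB t ht) (hβ0 t (Ioo_subset_Icc_self ht)).le
  have hαβ : AntitoneOn (fun t => α t + β t) (Icc a b) :=
    antitoneOn_Icc_of_hasDerivAt (hα.add hβ) (fun t ht => (hαd t ht).add (hβd t ht))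
      fun t ht => by nlinarith [hBA t ht, hβ0 t (Ioo_subset_Icc_self ht)]
  have ha : a ∈ Icc a b := ⟨le_rfl, hab⟩
  have hb : b ∈ Icc a b := ⟨hab, le_rfl⟩
  set x := α b + β b * s with hx
  set σ : ℝ → ℝ := fun t => (x - α t) / β t with hσ
  set r : ℝ := 1 - (1 - s) * β b / β a with hr
  have hr1 : r < 1 := by
    have := div_pos (mul_pos (sub_pos.2 hs.2) (hβ0 b hb)) (hβ0 a ha)
    linarith
  have hσ0 : ∀ t ∈ Icc a b, 0 ≤ σ t := fun t ht =>
    div_nonneg (by nlinarith [hαm ht hb ht.2, hβ0 b hb, hs.1]) (hβ0 t ht).le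
  have hσr : ∀ t ∈ Icc a b, σ t ≤ r := by
    intro t ht
    have h1 : (1 - s) * β b / β a ≤ (1 - s) * β b / β t :=
      div_le_div_of_nonneg_left (mul_nonneg (by linarith [hs.2]) (hβ0 b hb).le) (hβ0 t ht)
        (hβm ha ht ht.1)
    have h2 : σ t ≤ 1 - (1 - s) * β b / β t := by
      rw [hσ, div_le_iff₀ (hβ0 t ht), sub_mul, div_mul_cancel₀ _ (hβ0 t ht).ne']
      have := hαβ ht hb ht.2
      simp only at this
      rw [hx]; linarith
    linarith
  have hr0 : 0 ≤ r := (hσ0 a ha).trans (hσr a ha)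
  have hσb : σ b = s := by
    rw [hσ]; simp only [hx]
    rw [add_sub_cancel_left, mul_div_cancel_left₀ _ (hβ0 b hb).ne']
  have hσc : ContinuousOn σ (Icc a b) :=
    (continuousOn_const.sub hα).div hβ fun t ht => (hβ0 t ht).ne'
  have hσd : ∀ t ∈ Ioo a b, HasDerivAt σ (A t * σ t - B t) t := by
    intro t ht
    have hβt := (hβ0 t (Ioo_subset_Icc_self ht)).ne'
    refine (((hαd t ht).const_sub x).div (hβd t ht) hβt).congr_deriv ?_
    rw [hσ]
    field_simp
    ring
  let P : ℕ → ℝ → ℝ := fun N t => ∑ i ∈ Finset.range (N + 1), z i t * σ t ^ i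
  have hPc : ∀ N, ContinuousOn (P N) (Icc a b) := fun N =>
    continuousOn_finsetSum _ fun i _ => (hz i).mul (hσc.pow i)
  have hPd : ∀ N, ∀ t ∈ Ioo a b,
      HasDerivAt (P N) (B t * ((N + 1) * z (N + 1) t) * σ t ^ N) t := by
    intro N t ht
    induction N with
    | zero =>
      refine ((hd 0 t ht).congr_of_eventuallyEq (Eventually.of_forall fun u => ?_)).congr_deriv ?_
      · simp [P]
      · simp
    | succ N ih =>
      have h1 := ih.add ((hd (N + 1) t ht).mul ((hσd t ht).pow (N + 1)))
      refine (h1.congr_of_eventuallyEq (Eventually.of_forall fun u => ?_)).congr_deriv ?_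
      · simp [P, Finset.sum_range_succ]
      · simp only [Nat.add_sub_cancel, Pi.pow_apply]
        push_cast
        ring
  have hbound : ∀ N : ℕ, |P N b - P N a| ≤ (N + 1) * r ^ N * (C * (τ b - τ a)) := by
    intro N
    have hmem := fun t (ht : t ∈ Ioo a b) => Ioo_subset_Icc_self ht
    have hnn : ∀ t ∈ Ioo a b, 0 ≤ B t * ((N + 1) * z (N + 1) t) * σ t ^ N := fun t ht =>
      mul_nonneg (mul_nonneg (hB t ht) (mul_nonneg (by positivity) (hz0 _ t (hmem t ht))))
        (pow_nonneg (hσ0 t (hmem t ht)) _)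
    have hup : ∀ t ∈ Ioo a b, B t * ((N + 1) * z (N + 1) t) * σ t ^ N
        ≤ (N + 1) * r ^ N * C * τ' t := by
      intro t ht
      have e1 : z (N + 1) t * σ t ^ N ≤ 1 * r ^ N :=
        mul_le_mul (hz1 _ t (hmem t ht))
          (pow_le_pow_left₀ (hσ0 t (hmem t ht)) (hσr t (hmem t ht)) N)
          (pow_nonneg (hσ0 t (hmem t ht)) _) zero_le_one
      calc B t * ((N + 1) * z (N + 1) t) * σ t ^ N
          = B t * (N + 1) * (z (N + 1) t * σ t ^ N) := by ring
        _ ≤ B t * (N + 1) * (1 * r ^ N) :=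
          mul_le_mul_of_nonneg_left e1 (mul_nonneg (hB t ht) (by positivity))
        _ = B t * ((N + 1) * r ^ N) := by ring
        _ ≤ C * τ' t * ((N + 1) * r ^ N) :=
          mul_le_mul_of_nonneg_right (hBτ t ht) (by positivity)
        _ = _ := by ring
    have hmono := monotoneOn_Icc_of_hasDerivAt (hPc N) (hPd N) hnn ha hb hab
    have hanti := antitoneOn_Icc_of_hasDerivAt
      ((hPc N).sub (hτ.const_smul ((N + 1) * r ^ N * C)))
      (fun t ht => (hPd N t ht).sub ((hτd t ht).const_smul ((N + 1) * r ^ N * C)))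
      (fun t ht => by simpa using hup t ht) ha hb hab
    simp only [Pi.sub_apply, Pi.smul_apply, smul_eq_mul] at hanti
    rw [abs_of_nonneg (sub_nonneg.2 hmono)]
    linarith
  have hsum : ∀ t ∈ Icc a b, Summable (fun i => z i t) →
      Tendsto (fun N => P N t) atTop (𝓝 (genFun (fun i => z i t) (σ t))) := fun t ht hst =>
    ((hst.mul_pow_of_le_one (fun i => hz0 i t ht) (hσ0 t ht)
      ((hσr t ht).trans hr1.le) id).hasSum.tendsto_sum_nat).comp (tendsto_add_atTop_nat 1)
  have hlim0 : Tendsto (fun N : ℕ => ((N : ℝ) + 1) * r ^ N * (C * (τ b - τ a))) atTop (𝓝 0) := by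
    have h1 := (tendsto_self_mul_const_pow_of_lt_one hr0 hr1).add
      (tendsto_pow_atTop_nhds_zero_of_lt_one hr0 hr1)
    have h2 := h1.mul_const (C * (τ b - τ a))
    rw [add_zero, zero_mul] at h2
    exact h2.congr fun N => by ring
  have hdiff := ((hsum b hb hsb).sub (hsum a ha hsa)).abs
  have hle := le_of_tendsto_of_tendsto' hdiff hlim0 hbound
  have := abs_eq_zero.1 (le_antisymm hle (abs_nonneg _))
  rw [sub_eq_zero, hσb] at this
  exact this

end Flow

section Characteristics

variable {p q r A B γ G₁ G₂ : ℝ → ℝ} {a b M ε Γ : ℝ}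

/-- Two consecutive equations of the linear system determine its coefficients, and allow to
integrate the characteristic equations of the affine change of variable. -/
lemma exists_characteristics (hab : a ≤ b)
    (hp : ContinuousOn p (Icc a b)) (hq : ContinuousOn q (Icc a b)) (hr : ContinuousOn r (Icc a b))
    (hG₁ : ContinuousOn G₁ (Icc a b)) (hG₂ : ContinuousOn G₂ (Icc a b))
    (hG₁d : ∀ t ∈ Ioo a b, HasDerivAt G₁ (-(A t) * p t + B t * q t) t)
    (hG₂d : ∀ t ∈ Ioo a b, HasDerivAt G₂ (-(A t) * q t + B t * r t) t)
    (hp0 : ∀ t ∈ Icc a b, 0 ≤ p t) (hr0 : ∀ t ∈ Icc a b, 0 ≤ r t)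
    (hqM : ∀ t ∈ Icc a b, q t ≤ M) (hrM : ∀ t ∈ Icc a b, r t ≤ M)
    (hε : 0 < ε) (hqε : ∀ t ∈ Icc a b, ε ≤ q t) (hpq : ∀ t ∈ Icc a b, p t ≤ q t / 2)
    (hD : ∀ t ∈ Icc a b, 0 < q t ^ 2 - p t * r t)
    (hB : ∀ t ∈ Ioo a b, 0 ≤ B t) (hA : ∀ t ∈ Ioo a b, A t = B t + γ t)
    (hγ0 : ∀ t ∈ Ioo a b, 0 ≤ γ t) (hγ : ∀ t ∈ Ioo a b, γ t ≤ Γ) (α₀ β₀ : ℝ) (hβ₀ : 0 < β₀) :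
    ∃ (α β τ τ' : ℝ → ℝ) (C : ℝ), ContinuousOn α (Icc a b) ∧ ContinuousOn β (Icc a b) ∧
      (∀ t ∈ Ioo a b, HasDerivAt α (B t * β t) t) ∧
      (∀ t ∈ Ioo a b, HasDerivAt β (-(A t) * β t) t) ∧
      (∀ t, 0 < β t) ∧ α a = α₀ ∧ β a = β₀ ∧ ContinuousOn τ (Icc a b) ∧
      (∀ t ∈ Ioo a b, HasDerivAt τ (τ' t) t) ∧ ∀ t ∈ Ioo a b, B t ≤ C * τ' t := by
  rcases hab.eq_or_lt with rfl | hlt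
  · refine ⟨fun _ => α₀, fun _ => β₀, fun _ => 0, fun _ => 0, 0, continuousOn_const,
      continuousOn_const, ?_, ?_, fun _ => hβ₀, rfl, rfl, continuousOn_const, ?_, ?_⟩ <;> simp
  have hmem : ∀ {t}, t ∈ Ioo a b → t ∈ Icc a b := fun ht => Ioo_subset_Icc_self ht
  obtain ⟨u, hu⟩ : (Ioo a b).Nonempty := nonempty_Ioo.2 hlt
  have hΓ : 0 ≤ Γ := (hγ0 u hu).trans (hγ u hu)
  have hM : 0 < M := hε.trans_le ((hqε u (hmem hu)).trans (hqM u (hmem hu)))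
  set τ : ℝ → ℝ := fun t => (1 + Γ * M) * t + G₁ t with hτdef
  set τ' : ℝ → ℝ := fun t => (1 + Γ * M) * 1 + (-(A t) * p t + B t * q t) with hτ'def
  have hτ : ContinuousOn τ (Icc a b) := (continuousOn_const.mul continuousOn_id).add hG₁
  have hτd : ∀ t ∈ Ioo a b, HasDerivAt τ (τ' t) t := fun t ht =>
    ((hasDerivAt_id t).const_mul _).add (hG₁d t ht)
  have hτ1 : ∀ t ∈ Ioo a b, 1 + ε / 2 * B t ≤ τ' t := by
    intro t ht
    have h1 := hpq t (hmem ht)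
    have h2 := hqε t (hmem ht)
    have h3 : γ t * p t ≤ Γ * M := mul_le_mul (hγ t ht)
      (by linarith [hqM t (hmem ht)]) (hp0 t (hmem ht)) hΓ
    have h4 : ε / 2 * B t ≤ (q t - p t) * B t :=
      mul_le_mul_of_nonneg_right (by linarith) (hB t ht)
    simp only [hτ'def, hA t ht]
    nlinarith
  have hτ0 : ∀ t ∈ Ioo a b, 0 ≤ τ' t := fun t ht => by
    have := mul_nonneg (half_pos hε).le (hB t ht)
    linarith [hτ1 t ht]
  have hBτ : ∀ t ∈ Ioo a b, B t ≤ 2 / ε * τ' t := fun t ht => by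
    rw [div_mul_eq_mul_div, le_div_iff₀ hε]
    linarith [hτ1 t ht]
  have hAτ : ∀ t ∈ Ioo a b, A t ≤ (2 / ε + Γ) * τ' t := fun t ht => by
    have h1 := mul_nonneg (half_pos hε).le (hB t ht)
    have h2 : Γ * 1 ≤ Γ * τ' t := mul_le_mul_of_nonneg_left (by linarith [hτ1 t ht]) hΓ
    rw [hA t ht, add_mul]
    linarith [hBτ t ht, hγ t ht]
  have hA0 : ∀ t ∈ Ioo a b, 0 ≤ A t := fun t ht => by
    rw [hA t ht]; exact add_nonneg (hB t ht) (hγ0 t ht)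
  have habs : ∀ {x y : ℝ → ℝ}, (∀ t ∈ Icc a b, 0 ≤ x t ∧ x t ≤ M) →
      (∀ t ∈ Icc a b, 0 ≤ y t ∧ y t ≤ M) → ∀ t ∈ Ioo a b,
      |-(A t) * x t + B t * y t| ≤ M * (2 / ε + Γ + 2 / ε) * τ' t := by
    intro x y hx hy t ht
    have h1 : A t * x t ≤ (2 / ε + Γ) * τ' t * M := mul_le_mul (hAτ t ht) (hx t (hmem ht)).2
      (hx t (hmem ht)).1 ((hA0 t ht).trans (hAτ t ht))
    have h2 : B t * y t ≤ 2 / ε * τ' t * M := mul_le_mul (hBτ t ht) (hy t (hmem ht)).2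
      (hy t (hmem ht)).1 ((hB t ht).trans (hBτ t ht))
    have h3 := mul_nonneg (hA0 t ht) (hx t (hmem ht)).1
    have h4 := mul_nonneg (hB t ht) (hy t (hmem ht)).1
    rw [abs_le]
    constructor <;> nlinarith
  have hpM : ∀ t ∈ Icc a b, 0 ≤ p t ∧ p t ≤ M := fun t ht =>
    ⟨hp0 t ht, by linarith [hpq t ht, hqM t ht, hqε t ht]⟩
  have hqM' : ∀ t ∈ Icc a b, 0 ≤ q t ∧ q t ≤ M := fun t ht =>
    ⟨hε.le.trans (hqε t ht), hqM t ht⟩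
  have hD0 : ∀ t ∈ Icc a b, q t ^ 2 - p t * r t ≠ 0 := fun t ht => (hD t ht).ne'
  have hDc : ContinuousOn (fun t => q t ^ 2 - p t * r t) (Icc a b) := (hq.pow 2).sub (hp.mul hr)
  have hprim₁ := fun {φ : ℝ → ℝ} (hφ : ContinuousOn φ (Icc a b)) =>
    exists_primitive_mul_deriv hab hτ hτd hτ0 hG₁ hG₁d (habs hpM hqM') hφ
  have hprim₂ := fun {φ : ℝ → ℝ} (hφ : ContinuousOn φ (Icc a b)) =>
    exists_primitive_mul_deriv hab hτ hτd hτ0 hG₂ hG₂d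
      (habs hqM' fun t ht => ⟨hr0 t ht, hrM t ht⟩) hφ
  obtain ⟨I₁, hI₁c, hI₁a, hI₁d⟩ := hprim₁ (hr.div hDc hD0)
  obtain ⟨I₂, hI₂c, hI₂a, hI₂d⟩ := hprim₂ (hq.div hDc hD0)
  set β : ℝ → ℝ := fun t => β₀ * Real.exp (I₂ t - I₁ t) with hβdef
  have hβc : ContinuousOn β (Icc a b) := continuousOn_const.mul (hI₂c.sub hI₁c).rexp
  obtain ⟨J₁, hJ₁c, hJ₁a, hJ₁d⟩ := hprim₁ ((hβc.mul hq).div hDc hD0)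
  obtain ⟨J₂, hJ₂c, hJ₂a, hJ₂d⟩ := hprim₂ ((hβc.mul hp).div hDc hD0)
  refine ⟨fun t => α₀ + (J₁ t - J₂ t), β, τ, τ', 2 / ε, continuousOn_const.add (hJ₁c.sub hJ₂c),
    hβc, fun t ht => ?_, fun t ht => ?_, fun t => by positivity, by simp [hJ₁a, hJ₂a],
    by simp [hβdef, hI₁a, hI₂a], hτ, hτd, hBτ⟩
  · refine (((hJ₁d t ht).sub (hJ₂d t ht)).const_add α₀).congr_deriv ?_
    have := hD0 t (hmem ht)
    simp only [Pi.div_apply, Pi.mul_apply]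
    field_simp
    ring
  · refine ((((hI₂d t ht).sub (hI₁d t ht)).exp).const_mul β₀).congr_deriv ?_
    have := hD0 t (hmem ht)
    simp only [Pi.div_apply, hβdef, Pi.sub_apply]
    field_simp
    ring

end Characteristics

/-- Rate at which mass leaves a coordinate in the system (S). -/
noncomputable def lossRate (z : ℕ → ℝ) (ρ : ℝ) : ℝ := 1 / ρ * (Qmom z / Emom z) / Emom z

/-- Rate at which mass enters a coordinate in the system (S). -/
noncomputable def gainRate (z : ℕ → ℝ) (ρ : ℝ) : ℝ := 1 / ρ * (Qmom z / Emom z - 1) / Emom z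

lemma lossRate_eq (z : ℕ → ℝ) (ρ : ℝ) : lossRate z ρ = gainRate z ρ + 1 / ρ / Emom z := by
  rw [lossRate, gainRate]; ring

lemma isGreatest_root_of_ghat {z : ℕ → ℝ} {ρ : ℝ} (hE : 0 < Emom z)
    (h : IsGreatest {r | r ∈ Icc (0 : ℝ) 1 ∧ 1 - r = ghat z (1 - r)} ρ) :
    IsGreatest {r | r ∈ Icc (0 : ℝ) 1 ∧ genFun₁ z (1 - r) - (1 - r) * Emom z = 0} ρ := by
  convert h using 4 with r
  change _ ↔ _ = genFun₁ z (1 - r) / Emom z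
  rw [eq_div_iff hE.ne', sub_eq_zero, eq_comm]

namespace IsSolS

variable {π : ℕ → ℝ} {tmax : ℝ} {z : ℕ → ℝ → ℝ} {ρ : ℝ → ℝ} {t : ℝ}

lemma nonneg (h : IsSolS π tmax z ρ) (ht : t ∈ Ico 0 tmax) (i : ℕ) : 0 ≤ z i t := (h.2 t ht).1 i

lemma summable (h : IsSolS π tmax z ρ) (ht : t ∈ Ico 0 tmax) : Summable fun i => z i t :=
  (h.2 t ht).2.1

lemma le_one (h : IsSolS π tmax z ρ) (ht : t ∈ Ico 0 tmax) (i : ℕ) : z i t ≤ 1 :=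
  ((h.summable ht).le_tsum i fun j _ => h.nonneg ht j).trans (h.2 t ht).2.2.1

lemma summable₁ (h : IsSolS π tmax z ρ) (ht : t ∈ Ico 0 tmax) :
    Summable fun i : ℕ => (i : ℝ) * z i t := (h.2 t ht).2.2.2.1

lemma emom_pos (h : IsSolS π tmax z ρ) (ht : t ∈ Ico 0 tmax) : 0 < Emom fun i => z i t :=
  (h.2 t ht).2.2.2.2.1

lemma summable₂ (h : IsSolS π tmax z ρ) (ht : t ∈ Ico 0 tmax) :
    Summable fun i : ℕ => (i : ℝ) * ((i : ℝ) - 1) * z i t := (h.2 t ht).2.2.2.2.2.1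

lemma isGreatest (h : IsSolS π tmax z ρ) (ht : t ∈ Ico 0 tmax) :
    IsGreatest {r | r ∈ Icc (0 : ℝ) 1 ∧ 1 - r = ghat (fun i => z i t) (1 - r)} (ρ t) :=
  (h.2 t ht).2.2.2.2.2.2.1

lemma hasDerivWithinAt (h : IsSolS π tmax z ρ) (ht : t ∈ Ico 0 tmax) (i : ℕ) :
    HasDerivWithinAt (z i) (-lossRate (fun j => z j t) (ρ t) * (i * z i t)
      + gainRate (fun j => z j t) (ρ t) * ((i + 1) * z (i + 1) t)) (Ico 0 tmax) t :=
  ((h.2 t ht).2.2.2.2.2.2.2 i).congr_deriv (fS_eq _ _ i)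

lemma continuousOn (h : IsSolS π tmax z ρ) (i : ℕ) : ContinuousOn (z i) (Ico 0 tmax) :=
  fun _ ht => (h.hasDerivWithinAt ht i).continuousWithinAt

lemma gainRate_nonneg (h : IsSolS π tmax z ρ) (ht : t ∈ Ico 0 tmax) (hρ : 0 < ρ t) :
    0 ≤ gainRate (fun j => z j t) (ρ t) := by
  have hg := isGreatest_root_of_ghat (h.emom_pos ht) (h.isGreatest ht)
  have h1 := emom_le_qmom (h.nonneg ht) (h.summable₁ ht) (h.summable₂ ht) hρ hg.1.1.2
    (sub_eq_zero.1 hg.1.2)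
  have hE := h.emom_pos ht
  have h2 := (one_le_div hE).2 h1
  rw [gainRate]
  exact div_nonneg (mul_nonneg (by positivity) (by linarith)) hE.le

/-- Strict supercriticality at time `t` keeps `ρ` and `E` away from `0` near `t`. -/
lemma eventually_bounds (h : IsSolS π tmax z ρ) (ht : t ∈ Ico 0 tmax) {s : ℝ}
    (hs : s ∈ Ioo (0 : ℝ) 1) (hlt : genFun₁ (fun i => z i t) s < s * Emom fun i => z i t) :
    ∃ e > 0, ∀ᶠ u in 𝓝[Ico 0 tmax] t, 1 - s ≤ ρ u ∧ e ≤ Emom fun i => z i u := by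
  obtain ⟨e, he₁, he₂⟩ := exists_between ((div_lt_iff₀' hs.1).2 hlt)
  have he : 0 < e := (div_nonneg (genFun₁_nonneg (h.nonneg ht) hs.1.le) hs.1.le).trans_lt he₁
  have hcont : ContinuousOn (fun u => genFun₁ (fun i => z i u) s) (Ico 0 tmax) := by
    have hu : Summable fun i : ℕ => (i : ℝ) * s ^ (i - 1) := by
      refine (summable_nat_add_iff 1).1 ?_
      simpa [add_mul] using (hasSum_coe_mul_geometric_of_norm_lt_one
        (by rw [Real.norm_of_nonneg hs.1.le]; exact hs.2)).summable.add
          (summable_geometric_of_lt_one hs.1.le hs.2)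
    refine continuousOn_tsum (fun i => ((h.continuousOn i).const_smul (i : ℝ)).mul
      continuousOn_const) hu fun i u hu => ?_
    have h1 := h.nonneg hu i
    have h2 : (0 : ℝ) ≤ s ^ (i - 1) := pow_nonneg hs.1.le _
    have h3 : (0 : ℝ) ≤ i := i.cast_nonneg
    change ‖(i : ℝ) * z i u * s ^ (i - 1)‖ ≤ _
    rw [Real.norm_of_nonneg (by positivity)]
    exact mul_le_mul_of_nonneg_right (mul_le_of_le_one_right h3 (h.le_one hu i)) h2
  obtain ⟨N, hN⟩ := ((h.summable₁ ht).hasSum.tendsto_sum_nat.eventually_const_lt he₂).exists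
  have hpart : ContinuousOn (fun u => ∑ i ∈ Finset.range N, (i : ℝ) * z i u) (Ico 0 tmax) :=
    continuousOn_finsetSum _ fun i _ => continuousOn_const.mul (h.continuousOn i)
  refine ⟨e, he, ?_⟩
  filter_upwards [(hcont t ht).eventually_lt_const ((div_lt_iff₀' hs.1).1 he₁),
    (hpart t ht).eventually_const_lt hN, self_mem_nhdsWithin] with u hu1 hu2 hu
  have hE : e ≤ Emom fun i => z i u := hu2.le.trans <|
    (h.summable₁ hu).sum_le_tsum _ fun i _ => mul_nonneg i.cast_nonneg (h.nonneg hu i)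
  refine ⟨(lt_greatest_root (h := fun r => genFun₁ (fun i => z i u) (1 - r)
    - (1 - r) * Emom fun i => z i u) ?_ ?_ (isGreatest_root_of_ghat (h.emom_pos hu)
      (h.isGreatest hu)) ⟨by linarith [hs.2], by linarith [hs.1]⟩ ?_).le, hE⟩
  · refine ((continuousOn_genFun₁ (h.nonneg hu) (h.summable₁ hu)).comp (by fun_prop)
      fun r hr => ⟨?_, ?_⟩).sub (by fun_prop)
    · linarith [hr.2]
    · linarith [hr.1]
  · simpa using genFun₁_nonneg (h.nonneg hu) le_rfl
  · have := mul_le_mul_of_nonneg_left hE hs.1.le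
    simp only [sub_sub_cancel]
    linarith

end IsSolS

namespace IsSolS

variable {π : ℕ → ℝ} {l tmax : ℝ} {z : ℕ → ℝ → ℝ} {ρ : ℝ → ℝ} {t₀ c₀ : ℝ}

lemma exists_interval (h : IsSupercritical π l) (hz : IsSolS π tmax z ρ) (ht₀ : t₀ ∈ Ico 0 tmax)
    (hc₀ : c₀ ∈ Icc l 1) (h₀ : ∀ i, z i t₀ = affineComp π (shift₁ π c₀) (slope₁ π c₀) i) :
    ∃ t₁ > t₀, t₁ < tmax ∧ ∃ n : ℕ, ∃ ε > 0, ∃ Γ, ∀ t ∈ Icc t₀ t₁,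
      (0 < ρ t ∧ 1 / ρ t / (Emom fun i => z i t) ≤ Γ) ∧
      ε ≤ (n + 1) * z (n + 1) t ∧ n * z n t ≤ (n + 1) * z (n + 1) t / 2 ∧
      0 < ((n + 1) * z (n + 1) t) ^ 2 - n * z n t * ((n + 2) * z (n + 2) t) := by
  have hz₀ : (fun i => z i t₀) = affineComp π (shift₁ π c₀) (slope₁ π c₀) := funext h₀
  have hsl := h.slope₁_pos hc₀
  obtain ⟨r, hr, hrneg⟩ := h.exists_rootFun_neg hc₀ one_pos
  have hs : 1 - r ∈ Ioo (0 : ℝ) 1 := ⟨by linarith [hr.2], by linarith [hr.1]⟩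
  have hlt : genFun₁ (fun i => z i t₀) (1 - r) < (1 - r) * Emom fun i => z i t₀ := by
    rw [hz₀, h.emom_eq hc₀, h.genFun₁_affineComp (h.shift₁_nonneg hc₀) hsl.le
      (IsSupercritical.add_le_one hc₀) (Ioo_subset_Icc_self hs)]
    have : shift₁ π c₀ + slope₁ π c₀ * (1 - r) = c₀ - slope₁ π c₀ * r := by rw [shift₁]; ring
    rw [this]
    rw [rootFun] at hrneg
    nlinarith
  obtain ⟨e, he, hbd⟩ := hz.eventually_bounds ht₀ hs hlt
  have hex : ∃ k, 0 < k ∧ 0 < z k t₀ := by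
    by_contra! hcon
    have h0 : ∀ k : ℕ, (k : ℝ) * z k t₀ = 0 := fun k => by
      rcases k.eq_zero_or_pos with rfl | hk
      · simp
      · rw [le_antisymm (hcon k hk) (hz.nonneg ht₀ k), mul_zero]
    have := hz.emom_pos ht₀
    simp only [Emom, h0, tsum_zero, lt_self_iff_false] at this
  classical
  obtain ⟨n, hn⟩ := Nat.exists_eq_succ_of_ne_zero (Nat.find_spec hex).1.ne'
  have hpos : 0 < z (n + 1) t₀ := by
    have := (Nat.find_spec hex).2
    rwa [hn] at this
  have hzero : (n : ℝ) * z n t₀ = 0 := by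
    rcases n.eq_zero_or_pos with rfl | hn0
    · simp
    · have := Nat.find_min hex (m := n) (by omega)
      rw [not_and, not_lt] at this
      rw [le_antisymm (this hn0) (hz.nonneg ht₀ n), mul_zero]
  have hc := fun i => hz.continuousOn i t₀ ht₀
  have hp : ContinuousWithinAt (fun t => (n : ℝ) * z n t) (Ico 0 tmax) t₀ :=
    continuousWithinAt_const.mul (hc _)
  have hq : ContinuousWithinAt (fun t => ((n : ℝ) + 1) * z (n + 1) t) (Ico 0 tmax) t₀ :=
    continuousWithinAt_const.mul (hc _)
  have hr' : ContinuousWithinAt (fun t => ((n : ℝ) + 2) * z (n + 2) t) (Ico 0 tmax) t₀ :=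
    continuousWithinAt_const.mul (hc _)
  have hq0 : 0 < ((n : ℝ) + 1) * z (n + 1) t₀ := by positivity
  have hev : ∀ᶠ t in 𝓝[Ico 0 tmax] t₀, t < tmax ∧
      (0 < ρ t ∧ 1 / ρ t / (Emom fun i => z i t) ≤ 1 / r / e) ∧
      ((n : ℝ) + 1) * z (n + 1) t₀ / 2 ≤ (n + 1) * z (n + 1) t ∧
      n * z n t ≤ (n + 1) * z (n + 1) t / 2 ∧
      0 < ((n + 1) * z (n + 1) t) ^ 2 - n * z n t * ((n + 2) * z (n + 2) t) := by
    filter_upwards [hbd, self_mem_nhdsWithin, hq.eventually_const_lt (half_lt_self hq0),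
      (hp.sub (hq.div_const 2)).eventually_lt_const (by simpa [hzero] using hq0 : _ < (0 : ℝ)),
      ((hq.pow 2).sub (hp.mul hr')).eventually_const_lt
        (by simpa [hzero] using pow_pos hq0 2 : (0 : ℝ) < _)] with t h1 h2 h3 h4 h5
    have hrρ : r ≤ ρ t := by linarith [h1.1]
    refine ⟨h2.2, ⟨hr.1.trans_le hrρ, ?_⟩, h3.le, (sub_neg.1 h4).le, h5⟩
    exact div_le_div₀ (one_div_nonneg.2 hr.1.le) (one_div_le_one_div_of_le hr.1 hrρ) he h1.2
  have hge : Ico 0 tmax ∈ 𝓝[≥] t₀ :=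
    mem_of_superset (Ico_mem_nhdsGE ht₀.2) (Ico_subset_Ico_left ht₀.1)
  obtain ⟨t₁, ht₁, hsub⟩ := (mem_nhdsGE_iff_exists_Icc_subset).1
    (nhdsWithin_le_of_mem hge hev)
  exact ⟨t₁, ht₁, (hsub ⟨le_of_lt ht₁, le_rfl⟩).1, n, _, half_pos hq0, _,
    fun t ht => (hsub ht).2⟩

/-- As long as it is close to `π` in the affine family, a solution stays in the affine family. -/
lemma exists_affine (h : IsSupercritical π l) (hz : IsSolS π tmax z ρ) (ht₀ : t₀ ∈ Ico 0 tmax)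
    (hc₀ : c₀ ∈ Icc l 1) (h₀ : ∀ i, z i t₀ = affineComp π (shift₁ π c₀) (slope₁ π c₀) i) :
    ∃ t₁ > t₀, t₁ < tmax ∧ ∃ α β : ℝ → ℝ,
      ContinuousOn α (Icc t₀ t₁) ∧ ContinuousOn β (Icc t₀ t₁) ∧
      (∀ t ∈ Ioo t₀ t₁, HasDerivAt α (gainRate (fun i => z i t) (ρ t) * β t) t) ∧
      (∀ t ∈ Ioo t₀ t₁, HasDerivAt β (-lossRate (fun i => z i t) (ρ t) * β t) t) ∧
      α t₀ = shift₁ π c₀ ∧ β t₀ = slope₁ π c₀ ∧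
      ∀ t ∈ Icc t₀ t₁, 0 < ρ t ∧ 0 ≤ α t ∧ 0 < β t ∧ α t + β t ≤ c₀ ∧
        ∀ i, z i t = affineComp π (α t) (β t) i := by
  obtain ⟨t₁, ht₁, ht₁m, n, ε, hε, Γ, hbd⟩ := exists_interval h hz ht₀ hc₀ h₀
  have hsub : Icc t₀ t₁ ⊆ Ico 0 tmax := fun t ht => ⟨ht₀.1.trans ht.1, ht.2.trans_lt ht₁m⟩
  have hmem : ∀ {t}, t ∈ Ioo t₀ t₁ → t ∈ Icc t₀ t₁ := fun ht => Ioo_subset_Icc_self ht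
  have hzc : ∀ i, ContinuousOn (z i) (Icc t₀ t₁) := fun i => (hz.continuousOn i).mono hsub
  have hzd : ∀ i, ∀ t ∈ Ioo t₀ t₁, HasDerivAt (z i)
      (-lossRate (fun j => z j t) (ρ t) * (i * z i t)
        + gainRate (fun j => z j t) (ρ t) * ((i + 1) * z (i + 1) t)) t := fun i t ht =>
    (hz.hasDerivWithinAt (hsub (hmem ht)) i).hasDerivAt
      (Ico_mem_nhds (ht₀.1.trans_lt ht.1) (ht.2.trans ht₁m))
  have hγ0 : ∀ t ∈ Icc t₀ t₁, 0 ≤ 1 / ρ t / Emom fun i => z i t := fun t ht =>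
    div_nonneg (one_div_nonneg.2 (hbd t ht).1.1.le) (hz.emom_pos (hsub ht)).le
  have hB : ∀ t ∈ Icc t₀ t₁, 0 ≤ gainRate (fun i => z i t) (ρ t) := fun t ht =>
    hz.gainRate_nonneg (hsub ht) (hbd t ht).1.1
  have hz1 : ∀ (k : ℝ) (i : ℕ), 0 ≤ k → k ≤ n + 2 → ∀ t ∈ Icc t₀ t₁, k * z i t ≤ n + 2 :=
    fun k i hk0 hk t ht => (mul_le_of_le_one_right hk0 (hz.le_one (hsub ht) i)).trans hk
  have hn := n.cast_nonneg (α := ℝ)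
  obtain ⟨α, β, τ, τ', C, hα, hβ, hαd, hβd, hβ0, hα₀, hβ₀, hτ, hτd, hBτ⟩ :=
    exists_characteristics (p := fun t => n * z n t) (q := fun t => (n + 1) * z (n + 1) t)
      (r := fun t => (n + 2) * z (n + 2) t) (G₁ := z n) (G₂ := z (n + 1))
      (A := fun t => lossRate (fun i => z i t) (ρ t))
      (B := fun t => gainRate (fun i => z i t) (ρ t))
      (γ := fun t => 1 / ρ t / Emom fun i => z i t) (M := n + 2) (ε := ε) (Γ := Γ)
      ht₁.le (continuousOn_const.mul (hzc _)) (continuousOn_const.mul (hzc _))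
      (continuousOn_const.mul (hzc _)) (hzc _) (hzc _) (hzd n)
      (fun t ht => (hzd (n + 1) t ht).congr_deriv (by push_cast; ring))
      (fun t ht => mul_nonneg hn (hz.nonneg (hsub ht) n))
      (fun t ht => mul_nonneg (by positivity) (hz.nonneg (hsub ht) _))
      (hz1 _ _ (by positivity) (by linarith)) (hz1 _ _ (by positivity) le_rfl) hε
      (fun t ht => (hbd t ht).2.1) (fun t ht => (hbd t ht).2.2.1) (fun t ht => (hbd t ht).2.2.2)
      (fun t ht => hB t (hmem ht)) (fun t _ => lossRate_eq _ _) (fun t ht => hγ0 t (hmem ht))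
      (fun t ht => (hbd t (hmem ht)).1.2) (shift₁ π c₀) (slope₁ π c₀) (h.slope₁_pos hc₀)
  have hBA : ∀ t ∈ Icc t₀ t₁, gainRate (fun i => z i t) (ρ t) ≤ lossRate (fun i => z i t) (ρ t) :=
    fun t ht => by rw [lossRate_eq]; linarith [hγ0 t ht]
  have hαm : MonotoneOn α (Icc t₀ t₁) := monotoneOn_Icc_of_hasDerivAt hα hαd fun t ht =>
    mul_nonneg (hB t (hmem ht)) (hβ0 t).le
  have hαβ : AntitoneOn (fun t => α t + β t) (Icc t₀ t₁) :=
    antitoneOn_Icc_of_hasDerivAt (hα.add hβ) (fun t ht => (hαd t ht).add (hβd t ht))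
      fun t ht => by nlinarith [hBA t (hmem ht), hβ0 t]
  refine ⟨t₁, ht₁, ht₁m, α, β, hα, hβ, hαd, hβd, hα₀, hβ₀, fun t ht => ?_⟩
  have hleft : t₀ ∈ Icc t₀ t₁ := ⟨le_rfl, le_of_lt ht₁⟩
  have hα₀t : α t₀ ≤ α t := hαm hleft ht ht.1
  have hαt : 0 ≤ α t := (h.shift₁_nonneg hc₀).trans (hα₀ ▸ hα₀t)
  have hαβt : α t + β t ≤ c₀ := by
    have := hαβ hleft ht ht.1
    simpa only [hα₀, hβ₀, IsSupercritical.shift₁_add_slope₁] using this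
  have hαβ1 := hαβt.trans hc₀.2
  refine ⟨(hbd t ht).1.1, hαt, hβ0 t, hαβt, fun i => ?_⟩
  have hsub' : Icc t₀ t ⊆ Icc t₀ t₁ := Icc_subset_Icc_right ht.2
  have hsubo : Ioo t₀ t ⊆ Ioo t₀ t₁ := Ioo_subset_Ioo_right ht.2
  have hsum := h.hasSum_affineComp hαt (hβ0 t).le hαβ1
  refine sub_eq_zero.1 (eq_zero_of_tsum_mul_pow_eq_zero
    (d := fun i => z i t - affineComp π (α t) (β t) i)
    ((hz.summable (hsub ht)).sub hsum.summable) (fun s hs => ?_) i)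
  have hx1 : α t + β t * s ≤ 1 := by nlinarith [hs.2, hβ0 t]
  have hgen := hasSum_affineComp_mul_pow h.nonneg h.summable hαt (hβ0 t).le hs.1.le hx1
  have hgen₀ : genFun (fun i => z i t₀) ((α t + β t * s - α t₀) / β t₀)
      = genFun π (α t + β t * s) := by
    have hb₀ := hβ0 t₀
    have hx : shift₁ π c₀ + slope₁ π c₀ * ((α t + β t * s - α t₀) / β t₀) = α t + β t * s := by
      rw [← hα₀, ← hβ₀]; field_simp; ring
    have h1 := hasSum_affineComp_mul_pow h.nonneg h.summable (h.shift₁_nonneg hc₀)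
      (h.slope₁_pos hc₀).le (s := (α t + β t * s - α t₀) / β t₀)
      (div_nonneg (by nlinarith [hs.1, hβ0 t]) (hβ0 t₀).le) (hx.trans_le hx1)
    rw [hx] at h1
    rw [← h1.tsum_eq, genFun]
    exact tsum_congr fun j => by rw [h₀, mul_comm]
  have hflow := genFun_flow ht.1 (fun i => (hzc i).mono hsub')
    (fun i u hu => hz.nonneg (hsub (hsub' hu)) i) (fun i u hu => hz.le_one (hsub (hsub' hu)) i)
    (hz.summable ht₀) (hz.summable (hsub ht)) (fun i u hu => hzd i u (hsubo hu))
    (hα.mono hsub') (hβ.mono hsub') (fun u hu => hαd u (hsubo hu))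
    (fun u hu => hβd u (hsubo hu)) (fun u _ => hβ0 u) (fun u hu => hB u (hmem (hsubo hu)))
    (fun u hu => hBA u (hmem (hsubo hu))) (hτ.mono hsub') (fun u hu => hτd u (hsubo hu))
    (fun u hu => hBτ u (hsubo hu)) hs
  rw [hgen₀] at hflow
  have hzs := ((hz.summable (hsub ht)).mul_pow_of_le_one (hz.nonneg (hsub ht)) hs.1.le hs.2.le
    id).hasSum
  have := (hzs.sub hgen).tsum_eq
  rw [show ∑' i, z i t * s ^ id i = genFun π (α t + β t * s) from hflow, sub_self] at this
  rw [← this]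
  exact tsum_congr fun j => by simp only [id]; ring

end IsSolS

lemma eqOn_Icc_of_hasDerivAt_zero {f : ℝ → ℝ} {a b : ℝ} (hc : ContinuousOn f (Icc a b))
    (hd : ∀ t ∈ Ioo a b, HasDerivAt f 0 t) {t : ℝ} (ht : t ∈ Icc a b) : f t = f a :=
  have ha : a ∈ Icc a b := ⟨le_rfl, ht.1.trans ht.2⟩
  le_antisymm (antitoneOn_Icc_of_hasDerivAt hc hd (fun _ _ => le_rfl) ha ht ht.1)
    (monotoneOn_Icc_of_hasDerivAt hc hd (fun _ _ => le_rfl) ha ht ht.1)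

namespace IsSolS

variable {π : ℕ → ℝ} {l tmax : ℝ} {z : ℕ → ℝ → ℝ} {ρ T c : ℝ → ℝ} {t₀ : ℝ}

/-- A solution in the affine family locally coincides with the one driven by the clock `c`. -/
lemma exists_eq_clock (h : IsSupercritical π l) (hz : IsSolS π tmax z ρ)
    (hT : ∀ x ∈ Icc l 1, HasDerivAt T (-(greatestRoot π x * genFun₁ π x)) x)
    (hTc : ∀ t, T (c t) = t) (hcT : ∀ x, c (T x) = x) (ht₀ : t₀ ∈ Ico 0 tmax)
    (hc₀ : c t₀ ∈ Ioc l 1)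
    (h₀ : ∀ i, z i t₀ = affineComp π (shift₁ π (c t₀)) (slope₁ π (c t₀)) i) :
    ∃ t₁ > t₀, ∀ t ∈ Icc t₀ t₁, ∀ i, z i t = affineComp π (shift₁ π (c t)) (slope₁ π (c t)) i := by
  obtain ⟨t₂, ht₂, ht₂m, α, β, hα, hβ, hαd, hβd, hα₀, hβ₀, hbd⟩ :=
    exists_affine h hz ht₀ (Ioc_subset_Icc_self hc₀) h₀
  have hcc₀ : α t₀ + β t₀ = c t₀ := by rw [hα₀, hβ₀, IsSupercritical.shift₁_add_slope₁]
  obtain ⟨t₁, ht₁, hsub, hl⟩ : ∃ t₁ > t₀, Icc t₀ t₁ ⊆ Icc t₀ t₂ ∧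
      ∀ t ∈ Icc t₀ t₁, l ≤ α t + β t := by
    have hcont : ContinuousWithinAt (fun t => α t + β t) (Icc t₀ t₂) t₀ :=
      (hα.add hβ) t₀ ⟨le_rfl, le_of_lt ht₂⟩
    have hev := nhdsWithin_le_of_mem (Icc_mem_nhdsGE ht₂)
      ((hcont.eventually_const_lt (hc₀.1.trans_eq hcc₀.symm)).and self_mem_nhdsWithin)
    obtain ⟨t₁, ht₁, hsub⟩ := mem_nhdsGE_iff_exists_Icc_subset.1 hev
    exact ⟨t₁, ht₁, fun t ht => (hsub ht).2, fun t ht => (hsub ht).1.le⟩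
  have hsubo : Ioo t₀ t₁ ⊆ Ioo t₀ t₂ := Ioo_subset_Ioo_right (hsub ⟨le_of_lt ht₁, le_rfl⟩).2
  have hmem : ∀ {t}, t ∈ Ioo t₀ t₁ → t ∈ Icc t₀ t₁ := fun ht => Ioo_subset_Icc_self ht
  set x : ℝ → ℝ := fun t => α t + β t with hx
  have hxc : ContinuousOn x (Icc t₀ t₁) := (hα.add hβ).mono hsub
  have hxm : ∀ t ∈ Icc t₀ t₁, x t ∈ Icc l 1 := fun t ht =>
    ⟨hl t ht, (hbd t (hsub ht)).2.2.2.1.trans hc₀.2⟩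
  have hf : ∀ t ∈ Icc t₀ t₁, 0 < genFun₁ π (x t) := fun t ht =>
    h.genFun₁_pos (h.pos.trans_le (hxm t ht).1) (hxm t ht).2
  have hzeq : ∀ t ∈ Icc t₀ t₁, (fun i => z i t) = affineComp π (α t) (β t) := fun t ht =>
    funext (hbd t (hsub ht)).2.2.2.2
  have hE : ∀ t ∈ Icc t₀ t₁, (Emom fun i => z i t) = β t * genFun₁ π (x t) := fun t ht => by
    rw [hzeq t ht, h.emom_affineComp (hbd t (hsub ht)).2.1 (hbd t (hsub ht)).2.2.1.le (hxm t ht).2]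
  have hQ : ∀ t ∈ Icc t₀ t₁, (Qmom fun i => z i t) = β t ^ 2 * genFun₂ π (x t) := fun t ht => by
    rw [hzeq t ht, h.qmom_affineComp (hbd t (hsub ht)).2.1 (hbd t (hsub ht)).2.2.1.le (hxm t ht).2]
  have hxd : ∀ t ∈ Ioo t₀ t₁, HasDerivAt x (-(1 / (ρ t * genFun₁ π (x t)))) t := by
    intro t ht
    refine ((hαd t (hsubo ht)).add (hβd t (hsubo ht))).congr_deriv ?_
    have h1 := (hbd t (hsub (hmem ht))).2.2.1.ne'
    have h2 := (hf t (hmem ht)).ne'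
    have h3 := (hbd t (hsub (hmem ht))).1.ne'
    rw [lossRate_eq, hE t (hmem ht)]
    field_simp
    ring
  have hfd : ∀ t ∈ Ioo t₀ t₁, HasDerivAt (fun u => genFun₁ π (x u))
      (genFun₂ π (x t) * -(1 / (ρ t * genFun₁ π (x t)))) t := by
    intro t ht
    exact ((hasDerivWithinAt_genFun₁ h.nonneg h.summable₂ (h.mem_unit (hxm t (hmem ht)))).comp t
      (hxd t ht).hasDerivWithinAt
      (fun u hu => h.mem_unit (hxm u (hmem hu)))).hasDerivAt (Ioo_mem_nhds ht.1 ht.2)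
  have hslope : ∀ t ∈ Icc t₀ t₁, β t = slope₁ π (x t) := by
    intro t ht
    have hconst := eqOn_Icc_of_hasDerivAt_zero (f := fun u => β u / genFun₁ π (x u))
      ((hβ.mono hsub).div (h.continuousOn_genFun₁'.comp hxc hxm) fun u hu => (hf u hu).ne')
      (fun u hu => ((hβd u (hsubo hu)).div (hfd u hu) (hf u (hmem hu)).ne').congr_deriv (by
        have h1 := (hbd u (hsub (hmem hu))).2.2.1.ne'
        have h2 := (hf u (hmem hu)).ne'
        have h3 := (hbd u (hsub (hmem hu))).1.ne'
        rw [lossRate, hE u (hmem hu), hQ u (hmem hu)]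
        field_simp
        ring)) ht
    have hleft : t₀ ∈ Icc t₀ t₁ := ⟨le_rfl, le_of_lt ht₁⟩
    have hx₀ : x t₀ = c t₀ := hcc₀
    have h1 := hf t₀ hleft
    have h2 := h.genFun₁_one_pos.ne'
    simp only [hβ₀, slope₁, hx₀] at hconst h1
    rw [div_eq_iff (hf t ht).ne'] at hconst
    rw [hconst, slope₁]
    field_simp
  have hshift : ∀ t ∈ Icc t₀ t₁, α t = shift₁ π (x t) := fun t ht => by
    rw [shift₁, ← hslope t ht, hx]; ring
  have hρ : ∀ t ∈ Icc t₀ t₁, ρ t = greatestRoot π (x t) := by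
    intro t ht
    have h1 := hz.isGreatest (t := t) ⟨ht₀.1.trans ht.1, (hsub ht).2.trans_lt ht₂m⟩
    rw [hzeq t ht, hshift t ht, hslope t ht, h.setOf_ghat_eq (hxm t ht)] at h1
    exact h1.unique (h.isGreatest_greatestRoot (hxm t ht))
  have hclock : ∀ t ∈ Icc t₀ t₁, x t = c t := by
    intro t ht
    have hconst := eqOn_Icc_of_hasDerivAt_zero (f := fun u => T (x u) - u)
      (ContinuousOn.sub (ContinuousOn.comp (t := Icc l 1)
        (fun y hy => (hT y hy).continuousAt.continuousWithinAt) hxc hxm) continuousOn_id)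
      (fun u hu => (((hT _ (hxm u (hmem hu))).comp u (hxd u hu)).sub (hasDerivAt_id u)).congr_deriv
        (by
          have h2 := (hf u (hmem hu)).ne'
          have h3 := (hbd u (hsub (hmem hu))).1.ne'
          rw [← hρ u (hmem hu)]
          field_simp
          ring)) ht
    have hx₀ : x t₀ = c t₀ := hcc₀
    rw [hx₀, hTc, sub_self, sub_eq_zero] at hconst
    rw [← hcT (x t), hconst]
  exact ⟨t₁, ht₁, fun t ht i => by
    rw [(hbd t (hsub ht)).2.2.2.2 i, hshift t ht, hslope t ht, hclock t ht]⟩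

lemma eq_clock (h : IsSupercritical π l) (hz : IsSolS π tmax z ρ)
    (hT : ∀ x ∈ Icc l 1, HasDerivAt T (-(greatestRoot π x * genFun₁ π x)) x)
    (hTc : ∀ t, T (c t) = t) (hcT : ∀ x, c (T x) = x) (hc1 : c 0 = 1)
    (hmem : ∀ t ∈ Ico 0 tmax, c t ∈ Ioc l 1)
    (hcont : ∀ i, ContinuousOn (fun t => affineComp π (shift₁ π (c t)) (slope₁ π (c t)) i)
      (Ico 0 tmax)) (i : ℕ) {t : ℝ} (ht : t ∈ Ico 0 tmax) :
    z i t = affineComp π (shift₁ π (c t)) (slope₁ π (c t)) i := by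
  set w : ℕ → ℝ → ℝ := fun i t => affineComp π (shift₁ π (c t)) (slope₁ π (c t)) i
  have hsub : Icc 0 t ⊆ Ico 0 tmax := fun u hu => ⟨hu.1, hu.2.trans_lt ht.2⟩
  have hcl : IsClosed ({u | ∀ i, z i u = w i u} ∩ Icc 0 t) := by
    have : {u | ∀ i, z i u = w i u} ∩ Icc 0 t = ⋂ i, {u ∈ Icc 0 t | z i u = w i u} := by
      ext u
      simp only [mem_inter_iff, mem_ofPred_eq, mem_iInter]
      exact ⟨fun hu i => ⟨hu.2, hu.1 i⟩, fun hu => ⟨fun i => (hu i).2, (hu 0).1⟩⟩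
    rw [this]
    exact isClosed_iInter fun i => isClosed_Icc.isClosed_eq
      ((hz.continuousOn i).mono hsub) ((hcont i).mono hsub)
  refine hcl.Icc_subset_of_forall_exists_gt (fun i => ?_) (fun u hu y hy => ?_)
    (show t ∈ Icc 0 t from ⟨ht.1, le_rfl⟩) i
  · simp only [w, hc1, h.shift₁_one, h.slope₁_one, affineComp_zero_one, hz.1 i]
  · have hu' := hsub (Ico_subset_Icc_self hu.2)
    obtain ⟨t₁, ht₁, hev⟩ := exists_eq_clock h hz hT hTc hcT hu' (hmem u hu') hu.1
    exact ⟨min t₁ y, hev _ ⟨(lt_min ht₁ hy).le, min_le_left _ _⟩, lt_min ht₁ hy, min_le_right _ _⟩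

end IsSolS

/-- Lemma 1 of the paper: for a supercritical probability distribution `π` on `ℕ` with
finite second moment, the infinite system (S) of differential equations
`zᵢ'(t) = f_i(z₀(t), z₁(t), …)`, `zᵢ(0) = πᵢ`, has exactly one solution on some
interval `[0, tmax)` with `tmax > 0`. -/
theorem system_S_has_unique_solution
    (π : ℕ → ℝ) (hπ0 : ∀ i, 0 ≤ π i) (hπ1 : ∑' i : ℕ, π i = 1)
    (hmom : Summable fun k : ℕ => (k : ℝ) ^ 2 * π k)
    (hsup : (∑' k : ℕ, (k : ℝ) * ((k : ℝ) - 1) * π k) > ∑' k : ℕ, (k : ℝ) * π k) :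
    ∃ tmax > (0 : ℝ),
      (∃ z ρ, IsSolS π tmax z ρ) ∧
      ∀ z₁ ρ₁ z₂ ρ₂, IsSolS π tmax z₁ ρ₁ → IsSolS π tmax z₂ ρ₂ →
        ∀ i : ℕ, ∀ t ∈ Ico (0 : ℝ) tmax, z₁ i t = z₂ i t := by
  obtain ⟨l, h⟩ := exists_isSupercritical hπ0 hπ1 hmom hsup
  obtain ⟨T, c, hT, hTc, hcT, hc, hTm, hT1⟩ := h.exists_clock
  have hc1 : c 0 = 1 := by rw [← hT1, hcT]
  have hmem : ∀ t ∈ Ico 0 (T l), c t ∈ Ioc l 1 := fun t ht =>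
    ⟨hTm.lt_iff_gt.1 (by rw [hTc]; exact ht.2), hTm.le_iff_ge.1 (by rw [hTc, hT1]; exact ht.1)⟩
  have hsol := h.isSolS hT hTc hc hc1 fun t ht => Ioc_subset_Icc_self (hmem t ht)
  refine ⟨T l, hT1 ▸ hTm h.lt_one, ⟨_, _, hsol⟩, fun z₁ ρ₁ z₂ ρ₂ h₁ h₂ i t ht => ?_⟩
  rw [h₁.eq_clock h hT hTc hcT hc1 hmem hsol.continuousOn i ht,
    h₂.eq_clock h hT hTc hcT hc1 hmem hsol.continuousOn i ht]
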